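/- arXiv:2105.03257 — 5 statements merged into one kernel-verified Lean document; each statement's English description precedes it below -/
import Mathlib

section
/- For every choice of indices j, k, l ∈ {1, …, d} and every nonnegative θ ∈ C_c^∞(ℝ^d) equal to 1 on a neighborhood of the origin, the function Γ_{jkl} = ψ * ∂_j∂_k∂_l((1−θ)E) + (∂_j∂_k∂_l ψ) * (θE) belongs to L^1(ℝ^d); moreover Γ_{jkl} does not depend on the choice of θ: if θ' is another nonnegative C_c^∞ function equal to 1 near the origin, the corresponding function Γ'_{jkl} equals Γ_{jkl}. -/
open MeasureTheory SchwartzMap Filter Topology Real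
open scoped FourierTransform

noncomputable section

abbrev Euc (d : ℕ) := EuclideanSpace ℝ (Fin d)

/-- properties of the low-frequency cut-off function χ -/
structure IsCutoff (d : ℕ) (χ : Euc d → ℝ) : Prop where
  smooth : ContDiff ℝ (⊤ : ℕ∞) χ
  supp : ∀ x : Euc d, 2 ≤ ‖x‖ → χ x = 0
  one_near : ∃ ε > (0:ℝ), ∀ x : Euc d, ‖x‖ ≤ 1 + ε → χ x = 1
  radial_mono : ∀ x y : Euc d, ‖x‖ ≤ ‖y‖ → χ y ≤ χ x

/-- the canonical basis vector e_j of ℝ^d -/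
def ee (d : ℕ) (j : Fin d) : Euc d := EuclideanSpace.single j (1:ℝ)

/-- partial derivative ∂_j of a scalar function -/
def pd {d : ℕ} (j : Fin d) (f : Euc d → ℝ) : Euc d → ℝ :=
  fun x => fderiv ℝ f x (ee d j)

/-- third-order partial derivative ∂_j ∂_k ∂_l -/
def pd3 {d : ℕ} (j k l : Fin d) (f : Euc d → ℝ) : Euc d → ℝ :=
  pd j (pd k (pd l f))

/-- the Laplacian Δf = Σ_i ∂_i ∂_i f -/
def lap {d : ℕ} (f : Euc d → ℝ) : Euc d → ℝ :=
  fun x => ∑ i, pd i (pd i f) x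

/-- scalar convolution on ℝ^d -/
def cvS {d : ℕ} (g f : Euc d → ℝ) : Euc d → ℝ :=
  MeasureTheory.convolution g f (ContinuousLinearMap.mul ℝ ℝ) volume

/-- `E` is the fundamental solution of the Laplacian on ℝ^d:
`E(x) = C(d)|x|^{2-d}` for `d ≥ 3`, `E(x) = C(2) log |x|` for `d = 2`,
normalized so that `-ΔE = δ_0`. -/
structure IsFundSol (d : ℕ) (E : Euc d → ℝ) : Prop where
  form : if d = 2 then (∃ C : ℝ, ∀ x : Euc d, x ≠ 0 → E x = C * Real.log ‖x‖)
         else (∃ C : ℝ, 0 < C ∧ ∀ x : Euc d, x ≠ 0 → E x = C * ‖x‖ ^ (2 - (d:ℝ)))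
  fund : ∀ g : Euc d → ℝ, ContDiff ℝ (⊤ : ℕ∞) g → HasCompactSupport g →
    -∫ x, E x * lap g x = g 0

/-- `θ` is an admissible cut-off: smooth, compactly supported, nonnegative,
equal to 1 on a neighborhood of the origin. -/
structure IsBump (d : ℕ) (θ : Euc d → ℝ) : Prop where
  smooth : ContDiff ℝ (⊤ : ℕ∞) θ
  cptsupp : HasCompactSupport θ
  nonneg : ∀ x, 0 ≤ θ x
  one_near : ∃ ε > (0:ℝ), ∀ x : Euc d, ‖x‖ ≤ ε → θ x = 1

/-- the kernel `Γ_{jkl} = ψ * ∂_j∂_k∂_l((1-θ)E) + (∂_j∂_k∂_l ψ) * (θE)` -/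
def Gam {d : ℕ} (ψ : Euc d → ℝ) (E : Euc d → ℝ) (θ : Euc d → ℝ)
    (j k l : Fin d) : Euc d → ℝ :=
  fun x =>
    cvS ψ (pd3 j k l (fun y => (1 - θ y) * E y)) x
      + cvS (pd3 j k l ψ) (fun y => θ y * E y) x

lemma pd_smooth {d : ℕ} (j : Fin d) {f : Euc d → ℝ} (hf : ContDiff ℝ (⊤ : ℕ∞) f) :
    ContDiff ℝ (⊤ : ℕ∞) (pd j f) := by
  have h : ContDiff ℝ (⊤ : ℕ∞) (fderiv ℝ f) := hf.fderiv_right (by simp)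
  exact h.clm_apply contDiff_const

lemma pd3_smooth {d : ℕ} (j k l : Fin d) {f : Euc d → ℝ} (hf : ContDiff ℝ (⊤ : ℕ∞) f) :
    ContDiff ℝ (⊤ : ℕ∞) (pd3 j k l f) :=
  pd_smooth j (pd_smooth k (pd_smooth l hf))

lemma pd_cpt {d : ℕ} (j : Fin d) {f : Euc d → ℝ} (hf : HasCompactSupport f) :
    HasCompactSupport (pd j f) :=
  hf.fderiv_apply (𝕜 := ℝ) (ee d j)

lemma pd_comm {d : ℕ} (j k : Fin d) {f : Euc d → ℝ} (hf : ContDiff ℝ (⊤ : ℕ∞) f) :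
    pd j (pd k f) = pd k (pd j f) := by
  have h : ContDiff ℝ (⊤ : ℕ∞) (fderiv ℝ f) := hf.fderiv_right (by simp)
  have key : ∀ (a b : Fin d) (x : Euc d),
      pd a (pd b f) x = fderiv ℝ (fderiv ℝ f) x (ee d a) (ee d b) := by
    intro a b x
    have hd : DifferentiableAt ℝ (fderiv ℝ f) x := (h.differentiable (by simp)) x
    unfold pd
    rw [fderiv_clm_apply hd (differentiableAt_const _)]
    simp
  funext x
  rw [key, key]
  have := (hf.contDiffAt (x := x)).isSymmSndFDerivAt (by
    rw [minSmoothness_of_isRCLikeNormedField]; exact WithTop.coe_le_coe.2 (le_top : (2 : ℕ∞) ≤ ⊤))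
  exact this _ _

lemma pd_sub {d : ℕ} (j : Fin d) {f g : Euc d → ℝ} (hf : ContDiff ℝ (⊤ : ℕ∞) f)
    (hg : ContDiff ℝ (⊤ : ℕ∞) g) :
    pd j (fun x => f x - g x) = fun x => pd j f x - pd j g x := by
  funext x
  unfold pd
  rw [fderiv_fun_sub ((hf.differentiable (by simp)) x) ((hg.differentiable (by simp)) x)]
  simp

lemma pd3_sub {d : ℕ} (j k l : Fin d) {f g : Euc d → ℝ} (hf : ContDiff ℝ (⊤ : ℕ∞) f)
    (hg : ContDiff ℝ (⊤ : ℕ∞) g) :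
    pd3 j k l (fun x => f x - g x) = fun x => pd3 j k l f x - pd3 j k l g x := by
  unfold pd3
  rw [pd_sub l hf hg, pd_sub k (pd_smooth l hf) (pd_smooth l hg),
    pd_sub j (pd_smooth k (pd_smooth l hf)) (pd_smooth k (pd_smooth l hg))]

lemma pd_eqOn {d : ℕ} (j : Fin d) {f g : Euc d → ℝ} {U : Set (Euc d)} (hU : IsOpen U)
    (h : Set.EqOn f g U) : Set.EqOn (pd j f) (pd j g) U := by
  intro x hx
  have : f =ᶠ[𝓝 x] g := h.eventuallyEq_of_mem (hU.mem_nhds hx)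
  unfold pd
  rw [this.fderiv_eq]

lemma pd3_eqOn {d : ℕ} (j k l : Fin d) {f g : Euc d → ℝ} {U : Set (Euc d)} (hU : IsOpen U)
    (h : Set.EqOn f g U) : Set.EqOn (pd3 j k l f) (pd3 j k l g) U :=
  pd_eqOn j hU (pd_eqOn k hU (pd_eqOn l hU h))

lemma cvS_apply {d : ℕ} (f g : Euc d → ℝ) (x : Euc d) :
    cvS f g x = ∫ t, f t * g (x - t) := by
  simp [cvS, MeasureTheory.convolution]

lemma cvS_pd {d : ℕ} (j : Fin d) {f g : Euc d → ℝ} (hf : ContDiff ℝ (⊤ : ℕ∞) f)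
    (hg : ContDiff ℝ (⊤ : ℕ∞) g) (hgc : HasCompactSupport g) :
    cvS f (pd j g) = cvS (pd j f) g := by
  funext x
  rw [cvS_apply, cvS_apply]
  set G : Euc d → ℝ := fun t => g (x - t) with hG
  have hGs : ContDiff ℝ (⊤ : ℕ∞) G := hg.comp (contDiff_const.sub contDiff_id)
  have hGc : HasCompactSupport G := hgc.comp_homeomorph (Homeomorph.subLeft x)
  have hpG : ∀ t, pd j G t = - pd j g (x - t) := by
    intro t
    have h1 : HasFDerivAt (fun t : Euc d => x - t) (-(ContinuousLinearMap.id ℝ (Euc d))) t := by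
      simpa using (hasFDerivAt_id t).const_sub x
    have h2 := ((hg.differentiable (by simp)) (x - t)).hasFDerivAt.comp t h1
    have h3 : HasFDerivAt G _ t := h2
    unfold pd
    rw [h3.fderiv]
    simp
  have I : ∀ {u v : Euc d → ℝ}, ContDiff ℝ (⊤ : ℕ∞) u → ContDiff ℝ (⊤ : ℕ∞) v →
      HasCompactSupport v → Integrable (fun t => u t * v t) := by
    intro u v hu hv hvc
    exact (hu.continuous.mul hv.continuous).integrable_of_hasCompactSupport hvc.mul_left
  have := integral_mul_fderiv_eq_neg_fderiv_mul_of_integrable (f := f) (g := G)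
    (v := ee d j) (μ := (volume : Measure (Euc d)))
    (I (pd_smooth j hf) hGs hGc) (I hf (pd_smooth j hGs) (pd_cpt j hGc)) (I hf hGs hGc)
    (fun y _ => (hf.differentiable (by simp)) y) (fun y _ => (hGs.differentiable (by simp)) y)
  have e1 : ∀ t, f t * fderiv ℝ G t (ee d j) = -(f t * pd j g (x - t)) := by
    intro t
    have := hpG t
    unfold pd at this ⊢
    rw [this]; ring
  simp only [e1, integral_neg, neg_inj] at this
  exact this

lemma cvS_pd3 {d : ℕ} (j k l : Fin d) {f g : Euc d → ℝ} (hf : ContDiff ℝ (⊤ : ℕ∞) f)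
    (hg : ContDiff ℝ (⊤ : ℕ∞) g) (hgc : HasCompactSupport g) :
    cvS f (pd3 j k l g) = cvS (pd3 j k l f) g := by
  unfold pd3
  rw [cvS_pd j hf (pd_smooth k (pd_smooth l hg)) (pd_cpt k (pd_cpt l hgc)),
    cvS_pd k (pd_smooth j hf) (pd_smooth l hg) (pd_cpt l hgc),
    cvS_pd l (pd_smooth k (pd_smooth j hf)) hg hgc,
    pd_comm l k (pd_smooth j hf), pd_comm l j hf, pd_comm k j (pd_smooth l hf)]

lemma pd_schwartz {d : ℕ} (j : Fin d) (f : 𝓢(Euc d, ℝ)) :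
    ∃ g : 𝓢(Euc d, ℝ), pd j (⇑f) = ⇑g :=
  ⟨LineDeriv.lineDerivOp (ee d j) f, by
    funext x
    rw [SchwartzMap.lineDerivOp_apply_eq_fderiv]
    rfl⟩

lemma pd3_schwartz {d : ℕ} (j k l : Fin d) (f : 𝓢(Euc d, ℝ)) :
    ∃ g : 𝓢(Euc d, ℝ), pd3 j k l (⇑f) = ⇑g := by
  obtain ⟨g1, h1⟩ := pd_schwartz l f
  obtain ⟨g2, h2⟩ := pd_schwartz k g1
  obtain ⟨g3, h3⟩ := pd_schwartz j g2
  exact ⟨g3, by unfold pd3; rw [h1, h2, h3]⟩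

lemma schwartz_bdd {d : ℕ} (f : 𝓢(Euc d, ℝ)) : ∃ M, ∀ x, ‖f x‖ ≤ M := by
  obtain ⟨C, hC⟩ := f.decay 0 0
  exact ⟨C, fun x => by simpa using hC.2 x⟩

/-- homogeneity (up to an additive constant) passes to derivatives -/
lemma pd_homog {d : ℕ} (j : Fin d) {f : Euc d → ℝ} (a : ℝ)
    (h : ∀ t : ℝ, 0 < t → ∃ c : ℝ, ∀ x : Euc d, x ≠ 0 → f (t • x) = t ^ a * f x + c) :
    ∀ t : ℝ, 0 < t → ∀ x : Euc d, x ≠ 0 → pd j f (t • x) = t ^ (a - 1) * pd j f x := by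
  intro t ht x hx
  obtain ⟨c, hc⟩ := h t ht
  have e : (fun y => f (t • y)) =ᶠ[𝓝 x] fun y => t ^ a * f y + c := by
    filter_upwards [isOpen_ne.mem_nhds hx] with y hy
    exact hc y hy
  have e2 := e.fderiv_eq (𝕜 := ℝ)
  rw [fderiv_comp_smul, fderiv_add_const] at e2
  have e3 : fderiv ℝ (fun y => t ^ a * f y) x = t ^ a • fderiv ℝ f x := by
    have := fderiv_const_smul_field (𝕜 := ℝ) (f := f) (t ^ a)
    exact congrFun this x
  rw [e3] at e2
  have e4 := congrArg (fun L : Euc d →L[ℝ] ℝ => L (ee d j)) e2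
  simp only [smul_apply, smul_eq_mul] at e4
  unfold pd
  rw [Real.rpow_sub_one ht.ne', div_mul_eq_mul_div, ← e4]
  field_simp

lemma pd3_homog {d : ℕ} (j k l : Fin d) {f : Euc d → ℝ} (a : ℝ)
    (h : ∀ t : ℝ, 0 < t → ∃ c : ℝ, ∀ x : Euc d, x ≠ 0 → f (t • x) = t ^ a * f x + c) :
    ∀ t : ℝ, 0 < t → ∀ x : Euc d, x ≠ 0 → pd3 j k l f (t • x) = t ^ (a - 3) * pd3 j k l f x := by
  have h1 := pd_homog l a h
  have h2 := pd_homog k (f := pd l f) (a - 1) (fun t ht => ⟨0, fun x hx => by rw [h1 t ht x hx, add_zero]⟩)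
  have h3 := pd_homog j (f := pd k (pd l f)) (a - 1 - 1) (fun t ht => ⟨0, fun x hx => by rw [h2 t ht x hx, add_zero]⟩)
  intro t ht x hx
  have := h3 t ht x hx
  rw [show a - 1 - 1 - 1 = a - 3 by ring] at this
  exact this

lemma E_homog {d : ℕ} {E : Euc d → ℝ} (hE : IsFundSol d E) :
    ∀ t : ℝ, 0 < t → ∃ c : ℝ, ∀ x : Euc d, x ≠ 0 → E (t • x) = t ^ (2 - (d : ℝ)) * E x + c := by
  intro t ht
  have hform := hE.form
  split_ifs at hform with h2
  · obtain ⟨C, hC⟩ := hform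
    refine ⟨C * Real.log t, fun x hx => ?_⟩
    rw [hC _ (smul_ne_zero ht.ne' hx), hC x hx, norm_smul, Real.norm_of_nonneg ht.le,
      Real.log_mul ht.ne' (norm_ne_zero_iff.2 hx), show (2 : ℝ) - (d : ℝ) = 0 by rw [h2]; simp,
      Real.rpow_zero]
    ring
  · obtain ⟨C, -, hC⟩ := hform
    refine ⟨0, fun x hx => ?_⟩
    rw [hC _ (smul_ne_zero ht.ne' hx), hC x hx, norm_smul, Real.norm_of_nonneg ht.le,
      Real.mul_rpow ht.le (norm_nonneg x)]
    ring

lemma E_smoothAt {d : ℕ} {E : Euc d → ℝ} (hE : IsFundSol d E) {x : Euc d} (hx : x ≠ 0) :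
    ContDiffAt ℝ (⊤ : ℕ∞) E x := by
  have hform := hE.form
  have hn : ContDiffAt ℝ (⊤ : ℕ∞) (fun y : Euc d => ‖y‖) x := contDiffAt_norm ℝ hx
  have hn0 : ‖x‖ ≠ 0 := norm_ne_zero_iff.2 hx
  split_ifs at hform with h2
  · obtain ⟨C, hC⟩ := hform
    refine (contDiffAt_const.mul (hn.log hn0) : ContDiffAt ℝ (⊤ : ℕ∞) (fun y : Euc d => C * Real.log ‖y‖) x).congr_of_eventuallyEq ?_
    filter_upwards [isOpen_ne.mem_nhds hx] with y hy using hC y hy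
  · obtain ⟨C, -, hC⟩ := hform
    refine (contDiffAt_const.mul (hn.rpow_const_of_ne hn0) : ContDiffAt ℝ (⊤ : ℕ∞) (fun y : Euc d => C * ‖y‖ ^ (2 - (d : ℝ))) x).congr_of_eventuallyEq ?_
    filter_upwards [isOpen_ne.mem_nhds hx] with y hy using hC y hy

/-- a smooth function vanishing near the origin times `E` is smooth -/
lemma mul_E_smooth {d : ℕ} {E : Euc d → ℝ} (hE : IsFundSol d E) {η : Euc d → ℝ}
    (hη : ContDiff ℝ (⊤ : ℕ∞) η) {ε : ℝ} (hε : 0 < ε) (h0 : ∀ x : Euc d, ‖x‖ ≤ ε → η x = 0) :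
    ContDiff ℝ (⊤ : ℕ∞) (fun y => η y * E y) := by
  rw [contDiff_iff_contDiffAt]
  intro x
  by_cases hx : x = 0
  · subst hx
    refine (contDiffAt_const (c := (0 : ℝ))).congr_of_eventuallyEq ?_
    filter_upwards [Metric.ball_mem_nhds (0 : Euc d) hε] with y hy
    rw [h0 y (by simpa using (mem_ball_zero_iff.1 hy).le), zero_mul]
  · exact hη.contDiffAt.mul (E_smoothAt hE hx)

lemma one_sub_mul_E_smooth {d : ℕ} {E : Euc d → ℝ} (hE : IsFundSol d E) {θ : Euc d → ℝ}
    (hθ : IsBump d θ) : ContDiff ℝ (⊤ : ℕ∞) (fun y => (1 - θ y) * E y) := by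
  obtain ⟨ε, hε, h1⟩ := hθ.one_near
  exact mul_E_smooth hE (contDiff_const.sub hθ.smooth) hε (fun x hx => by rw [h1 x hx, sub_self])

lemma bump_radius {d : ℕ} {θ : Euc d → ℝ} (hθ : IsBump d θ) :
    ∃ R : ℝ, 1 ≤ R ∧ ∀ x : Euc d, R < ‖x‖ → θ x = 0 := by
  obtain ⟨R, hR⟩ := hθ.cptsupp.isCompact.isBounded.subset_closedBall (0 : Euc d)
  refine ⟨max R 1, le_max_right _ _, fun x hx => ?_⟩
  by_contra hne
  have := hR (subset_tsupport θ hne)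
  rw [mem_closedBall_zero_iff] at this
  linarith [le_max_left R 1]

lemma pd3_decay {d : ℕ} {E : Euc d → ℝ} (hE : IsFundSol d E) {θ : Euc d → ℝ}
    (hθ : IsBump d θ) (j k l : Fin d) :
    ∃ M : ℝ, ∀ x, ‖pd3 j k l (fun y => (1 - θ y) * E y) x‖ ≤ M * (1 + ‖x‖) ^ (-((d : ℝ) + 1)) := by
  set F : Euc d → ℝ := fun y => (1 - θ y) * E y with hF
  have hFs : ContDiff ℝ (⊤ : ℕ∞) F := one_sub_mul_E_smooth hE hθ
  obtain ⟨R, hR1, hR⟩ := bump_radius hθ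
  have hcont := (pd3_smooth j k l hFs).continuous
  obtain ⟨B, hB⟩ := (isCompact_closedBall (0 : Euc d) (2 * R)).exists_bound_of_continuousOn
    hcont.continuousOn
  have hR0 : 0 < R := by linarith
  have hopen : IsOpen {x : Euc d | R < ‖x‖} := isOpen_lt continuous_const continuous_norm
  have heq : Set.EqOn (pd3 j k l F) (pd3 j k l E) {x : Euc d | R < ‖x‖} := by
    refine pd3_eqOn j k l hopen ?_
    intro x hx
    simp [hF, hR x hx]
  have hhom := pd3_homog j k l _ (E_homog hE)
  have hB0 : 0 ≤ B := (norm_nonneg _).trans (hB 0 (by simp; linarith))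
  refine ⟨B * (1 + 2 * R) ^ ((d : ℝ) + 1), fun x => ?_⟩
  have hd1 : (0 : ℝ) ≤ (d : ℝ) + 1 := by positivity
  have hdiv : B * (1 + 2 * R) ^ ((d : ℝ) + 1) * (1 + ‖x‖) ^ (-((d : ℝ) + 1))
      = B * ((1 + 2 * R) / (1 + ‖x‖)) ^ ((d : ℝ) + 1) := by
    rw [Real.rpow_neg (by positivity), Real.div_rpow (by positivity) (by positivity)]
    ring
  rw [hdiv]
  by_cases hx : ‖x‖ ≤ 2 * R
  · refine (hB x (by simpa using hx)).trans ?_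
    refine le_mul_of_one_le_right hB0 (Real.one_le_rpow ?_ hd1)
    rw [one_le_div (by positivity)]
    linarith
  · push Not at hx
    have hx0 : 0 < ‖x‖ := by linarith
    set y : Euc d := (2 * R / ‖x‖) • x with hy
    have hyn : ‖y‖ = 2 * R := by
      rw [hy, norm_smul, Real.norm_of_nonneg (by positivity)]
      field_simp
    have hyne : y ≠ 0 := by
      intro h; rw [h, norm_zero] at hyn; linarith
    have hxy : x = (‖x‖ / (2 * R)) • y := by
      rw [hy, smul_smul]
      rw [show ‖x‖ / (2 * R) * (2 * R / ‖x‖) = 1 by field_simp, one_smul]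
    have hxF : pd3 j k l F x = (‖x‖ / (2 * R)) ^ (-((d : ℝ) + 1)) * pd3 j k l F y := by
      rw [heq (show R < ‖x‖ by linarith), heq (show R < ‖y‖ by linarith)]
      conv_lhs => rw [hxy]
      rw [hhom _ (by positivity) y hyne]
      congr 2
      ring
    have hpos : 0 ≤ (‖x‖ / (2 * R)) ^ (-((d : ℝ) + 1)) := by positivity
    rw [hxF, norm_mul, Real.norm_of_nonneg hpos, mul_comm]
    refine mul_le_mul (hB y (by simp [hyn])) ?_ hpos hB0
    rw [Real.rpow_neg (by positivity), ← Real.inv_rpow (by positivity)]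
    refine Real.rpow_le_rpow (by positivity) ?_ hd1
    rw [inv_div, div_le_div_iff₀ hx0 (by positivity)]
    nlinarith

lemma pd3_integrable {d : ℕ} {E : Euc d → ℝ} (hE : IsFundSol d E) {θ : Euc d → ℝ}
    (hθ : IsBump d θ) (j k l : Fin d) :
    Integrable (pd3 j k l (fun y => (1 - θ y) * E y)) := by
  obtain ⟨M, hM⟩ := pd3_decay hE hθ j k l
  have h1 : Integrable (fun x : Euc d => (1 + ‖x‖) ^ (-((d : ℝ) + 1))) :=
    integrable_one_add_norm (by simp)
  exact (h1.const_mul M).mono'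
    (pd3_smooth j k l (one_sub_mul_E_smooth hE hθ)).continuous.aestronglyMeasurable
    (Eventually.of_forall hM)

lemma pd3_bdd {d : ℕ} {E : Euc d → ℝ} (hE : IsFundSol d E) {θ : Euc d → ℝ}
    (hθ : IsBump d θ) (j k l : Fin d) :
    ∃ M : ℝ, ∀ x, ‖pd3 j k l (fun y => (1 - θ y) * E y) x‖ ≤ M := by
  obtain ⟨M, hM⟩ := pd3_decay hE hθ j k l
  have hM0 : 0 ≤ M := by
    have := (norm_nonneg _).trans (hM 0)
    simpa using this
  refine ⟨M, fun x => (hM x).trans (mul_le_of_le_one_right hM0 ?_)⟩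
  refine Real.rpow_le_one_of_one_le_of_nonpos (by linarith [norm_nonneg x]) ?_
  have : (0 : ℝ) ≤ d := by positivity
  linarith

lemma theta_E_integrable {d : ℕ} (hd : 2 ≤ d) {E : Euc d → ℝ} (hE : IsFundSol d E)
    {θ : Euc d → ℝ} (hθ : IsBump d θ) : Integrable (fun y => θ y * E y) := by
  have : Nonempty (Fin d) := ⟨⟨0, by omega⟩⟩
  obtain ⟨R, hR1, hR⟩ := bump_radius hθ
  obtain ⟨φ, hφ, hcont⟩ : ∃ φ : ℝ → ℝ, (∀ x : Euc d, x ≠ 0 → E x = φ ‖x‖) ∧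
      ∃ q : ℝ → ℝ, Continuous q ∧ ∀ y : ℝ, 0 < y → y ^ (d - 1) • φ y = q y := by
    have hform := hE.form
    split_ifs at hform with h2
    · obtain ⟨C, hC⟩ := hform
      refine ⟨fun y => C * Real.log y, hC, fun y => C * (y * Real.log y),
        continuous_const.mul Real.continuous_mul_log, fun y hy => ?_⟩
      subst h2
      simp
      ring
    · obtain ⟨C, -, hC⟩ := hform
      refine ⟨fun y => C * y ^ (2 - (d : ℝ)), hC, fun y => C * y, by fun_prop, fun y hy => ?_⟩
      have : y ^ (d - 1) * y ^ (2 - (d : ℝ)) = y := by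
        rw [← Real.rpow_natCast, ← Real.rpow_add hy, Nat.cast_sub (by omega)]
        rw [show ((d : ℝ) - (1 : ℕ)) + (2 - (d : ℝ)) = 1 by push_cast; ring, Real.rpow_one]
      simp only [smul_eq_mul]
      calc y ^ (d - 1) * (C * y ^ (2 - (d : ℝ))) = C * (y ^ (d - 1) * y ^ (2 - (d : ℝ))) := by ring
        _ = C * y := by rw [this]
  obtain ⟨q, hq, hqe⟩ := hcont
  have hint : Integrable (fun x : Euc d => (Set.Iic R).indicator φ ‖x‖) := by
    rw [integrable_fun_norm_addHaar (volume : Measure (Euc d)) (f := (Set.Iic R).indicator φ)]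
    have h1 : Integrable ((Set.Icc 0 R).indicator q) :=
      (hq.continuousOn.integrableOn_compact isCompact_Icc).integrable_indicator measurableSet_Icc
    refine h1.integrableOn.congr_fun ?_ measurableSet_Ioi
    intro y hy
    have hy' : 0 < y := hy
    by_cases hyR : y ≤ R
    · simp only [finrank_euclideanSpace, Fintype.card_fin]
      rw [Set.indicator_of_mem (show y ∈ Set.Icc 0 R from ⟨hy'.le, hyR⟩),
        Set.indicator_of_mem (show y ∈ Set.Iic R from hyR), hqe y hy']
    · simp [Set.indicator, hyR]
  obtain ⟨B, hB⟩ := hθ.cptsupp.exists_bound_of_continuous hθ.smooth.continuous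
  have h2 := hint.bdd_mul hθ.smooth.continuous.aestronglyMeasurable (Eventually.of_forall hB)
  refine h2.congr ?_
  have hne : ∀ᵐ x : Euc d, x ≠ 0 := by
    simp [ae_iff]
  filter_upwards [hne] with x hx
  by_cases hxR : ‖x‖ ≤ R
  · rw [Set.indicator_of_mem (show ‖x‖ ∈ Set.Iic R from hxR), hφ x hx]
  · rw [hR x (not_le.1 hxR), zero_mul, zero_mul]

/-- `Γ_{jkl}` is an `L^1` function and does not depend on
the choice of the cut-off `θ`. -/
theorem Gamma_integrable_and_indep
    (d : ℕ) (hd : 2 ≤ d)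
    (χ : Euc d → ℝ) (hχ : IsCutoff d χ)
    (ψ : 𝓢(Euc d, ℝ))
    (hψ : ∀ ξ : Euc d, 𝓕 (fun x => (ψ x : ℂ)) ξ = (χ ξ : ℂ))
    (E : Euc d → ℝ) (hE : IsFundSol d E)
    (θ θ' : Euc d → ℝ) (hθ : IsBump d θ) (hθ' : IsBump d θ')
    (j k l : Fin d) :
    Integrable (Gam (⇑ψ) E θ j k l) volume ∧
    Gam (⇑ψ) E θ j k l = Gam (⇑ψ) E θ' j k l := by
  have hFi := pd3_integrable hE hθ j k l
  have hFb := pd3_bdd hE hθ j k l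
  have hFb' := pd3_bdd hE hθ' j k l
  have hFs := one_sub_mul_E_smooth hE hθ
  have hFs' := one_sub_mul_E_smooth hE hθ'
  have hTi := theta_E_integrable hd hE hθ
  have hTi' := theta_E_integrable hd hE hθ'
  obtain ⟨P, hP⟩ := pd3_schwartz j k l ψ
  constructor
  · have h1 : Integrable (cvS (⇑ψ) (pd3 j k l (fun y => (1 - θ y) * E y))) :=
      ψ.integrable.integrable_convolution _ hFi
    have h2 : Integrable (cvS (pd3 j k l (⇑ψ)) (fun y => θ y * E y)) := by
      rw [hP]
      exact P.integrable.integrable_convolution _ hTi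
    exact h1.add h2
  · have hg : ContDiff ℝ (⊤ : ℕ∞) (fun y => (1 - θ y) * E y - (1 - θ' y) * E y) := hFs.sub hFs'
    have hgc : HasCompactSupport (fun y => (1 - θ y) * E y - (1 - θ' y) * E y) := by
      have : (fun y => (1 - θ y) * E y - (1 - θ' y) * E y) = fun y => (θ' y - θ y) * E y := by
        funext y; ring
      rw [this]
      exact (hθ'.cptsupp.sub hθ.cptsupp).mul_right
    have key := cvS_pd3 j k l (ψ.smooth ⊤) hg hgc
    rw [pd3_sub j k l hFs hFs'] at key
    funext x
    have kx := congrFun key x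
    unfold Gam
    have I1 : ∀ {u : Euc d → ℝ}, Continuous u → (∃ M, ∀ x, ‖u x‖ ≤ M) →
        Integrable (fun t => ψ t * u (x - t)) := by
      rintro u hu ⟨M, hM⟩
      exact ψ.integrable.mul_bdd (hu.comp (continuous_const.sub continuous_id)).aestronglyMeasurable
        (Eventually.of_forall fun t => hM _)
    have I2 : ∀ {u : Euc d → ℝ}, Integrable u → Integrable (fun t => P t * u (x - t)) := by
      intro u hu
      obtain ⟨M, hM⟩ := schwartz_bdd P
      exact (hu.comp_sub_left x).bdd_mul P.continuous.aestronglyMeasurable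
        (Eventually.of_forall hM)
    rw [hP] at kx ⊢
    simp only [cvS_apply] at kx ⊢
    have e1 := integral_sub (I1 (pd3_smooth j k l hFs).continuous hFb)
      (I1 (pd3_smooth j k l hFs').continuous hFb')
    have e2 := integral_sub (I2 hTi') (I2 hTi)
    have e3 : ∀ t, P t * ((1 - θ (x - t)) * E (x - t) - (1 - θ' (x - t)) * E (x - t))
        = P t * (θ' (x - t) * E (x - t)) - P t * (θ (x - t) * E (x - t)) := by
      intro t; ring
    simp only [e3, mul_sub (ψ _)] at kx
    rw [e1, e2] at kx
    linarith

end
end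

section
/- Let s ∈ ℝ and p, r ∈ [1,∞] satisfy the supercriticality condition s ≤ d/p, with r = 1 in the case s = d/p. Let u ∈ S'(ℝ^d) be a tempered distribution such that the sequence (2^{ms} ‖Δ̇_m u‖_{L^p})_{m ∈ ℤ} belongs to ℓ^r(ℤ). Then u can be recovered from its homogeneous Littlewood–Paley decomposition up to a polynomial: there exists a polynomial Q ∈ ℝ[x] such that u = Q + Σ_{m ∈ ℤ} Δ̇_m u, the series converging in S'(ℝ^d). -/
open MeasureTheory SchwartzMap Filter Topology Real
open scoped FourierTransform ENNReal

noncomputable section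

/-- tempered distributions on ℝ^d -/
abbrev TD (d : ℕ) := 𝓢(Euc d, ℝ) →L[ℝ] ℝ

/-- the convolution kernel of the homogeneous block `Δ̇_0 = φ₀(D)`,
`h = ψ - 2^{-d} ψ(·/2)`, whose Fourier transform is `φ₀(ξ) = χ(ξ) - χ(2ξ)` -/
def lpker {d : ℕ} (ψ : Euc d → ℝ) : Euc d → ℝ :=
  fun x => ψ x - ((2:ℝ) ^ d)⁻¹ * ψ ((2:ℝ)⁻¹ • x)

/-- the convolution kernel `2^{md} φ̌₀(2^m ·)` of the homogeneous dyadic block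
`Δ̇_m = φ₀(2^{-m}D)`, `m ∈ ℤ` -/
def hkerZ {d : ℕ} (ψ : Euc d → ℝ) (m : ℤ) : Euc d → ℝ :=
  fun x => (2:ℝ) ^ (m * (d:ℤ)) * lpker ψ ((2:ℝ) ^ m • x)

section LPAnalysis

/-- If all derivatives of order `< M` vanish at `0`, Taylor bounds. -/
lemma lp_taylor {E : Type*} [NormedAddCommGroup E] [NormedSpace ℝ E] {f : E → ℂ} {M : ℕ} {C : ℝ}
    (hf : ContDiff ℝ (⊤ : ℕ∞) f) (h0 : ∀ i < M, iteratedFDeriv ℝ i f 0 = 0)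
    (hC : ∀ x, ‖iteratedFDeriv ℝ M f x‖ ≤ C) (k : ℕ) (hk : k ≤ M) (x : E) :
    ‖iteratedFDeriv ℝ (M - k) f x‖ ≤ C * ‖x‖ ^ k := by
  induction k generalizing x with
  | zero => simpa using hC x
  | succ k ih =>
    have hC0 : 0 ≤ C := (norm_nonneg _).trans (hC 0)
    have e : M - k = (M - (k+1)) + 1 := by omega
    have hdiff : Differentiable ℝ (iteratedFDeriv ℝ (M - (k+1)) f) :=
      hf.differentiable_iteratedFDeriv (WithTop.coe_lt_coe.2 (ENat.natCast_lt_top _))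
    have := (convex_closedBall (0:E) ‖x‖).norm_image_sub_le_of_norm_fderiv_le (𝕜 := ℝ)
      (f := iteratedFDeriv ℝ (M - (k+1)) f) (C := C * ‖x‖ ^ k) (x := 0) (y := x)
      (fun y _ => hdiff y) (fun y hy => by
        rw [norm_fderiv_iteratedFDeriv, ← e]
        refine (ih (by omega) y).trans ?_
        have : ‖y‖ ≤ ‖x‖ := by simpa using hy
        gcongr) (by simp) (by simp)
    rw [h0 _ (by omega), sub_zero, sub_zero] at this
    rw [pow_succ, ← mul_assoc]
    exact this

variable {E : Type*} [NormedAddCommGroup E] [NormedSpace ℝ E]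

lemma lp_tg (X : 𝓢(E, ℝ)) (t : ℝ) : Function.HasTemperateGrowth (fun ξ => X (t • ξ)) := by
  have h1 : Function.HasTemperateGrowth (fun ξ : E => t • ξ) := by fun_prop
  exact X.hasTemperateGrowth.comp h1

lemma lp_mul_deriv {a : E → ℝ} (ha : ContDiff ℝ (⊤ : ℕ∞) a) (f : 𝓢(E, ℂ)) (t : ℝ) (ht : 0 ≤ t)
    (j : ℕ) (x : E) :
    ‖iteratedFDeriv ℝ j (fun y => a (t • y) • f y) x‖ ≤ ∑ i ∈ Finset.range (j + 1),
      (j.choose i : ℝ) * (t ^ i * ‖iteratedFDeriv ℝ i a (t • x)‖) * ‖iteratedFDeriv ℝ (j - i) f x‖ := by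
  refine (norm_iteratedFDeriv_smul_le (N := ((⊤:ℕ∞) : WithTop ℕ∞)) (by fun_prop) (f.smooth ⊤) x
    (by exact_mod_cast le_top)).trans (le_of_eq ?_)
  refine Finset.sum_congr rfl fun i _ => ?_
  rw [iteratedFDeriv_comp_const_smul t (ha.of_le (by exact_mod_cast le_top))]
  simp [norm_smul, abs_of_nonneg ht]

/-- low frequency decay -/
lemma lp_low (X : 𝓢(E, ℝ)) (f : 𝓢(E, ℂ)) (M k j : ℕ) (hj : j < M)
    (h0 : ∀ i < M, iteratedFDeriv ℝ i f 0 = 0) :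
    ∃ C : ℝ, ∀ t : ℝ, 1 ≤ t →
      SchwartzMap.seminorm ℝ k j (smulLeftCLM ℂ (fun ξ => X (t • ξ)) f) ≤ C / t := by
  set B := SchwartzMap.seminorm ℝ 0 M f
  refine ⟨∑ i ∈ Finset.range (j + 1), (j.choose i : ℝ) *
    SchwartzMap.seminorm ℝ (k + (M - (j - i))) i X * B, fun t ht => ?_⟩
  have ht0 : 0 < t := by linarith
  refine SchwartzMap.seminorm_le_bound ℝ k j _ (by positivity) fun x => ?_
  rw [smulLeftCLM_apply (lp_tg X t)]
  refine (mul_le_mul_of_nonneg_left (lp_mul_deriv (X.smooth ⊤) f t ht0.le j x) (by positivity)).trans ?_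
  rw [Finset.mul_sum, Finset.sum_div]
  refine Finset.sum_le_sum fun i hi => ?_
  have hi' : i ≤ j := by simpa [Nat.lt_succ_iff] using hi
  have h1 : ‖iteratedFDeriv ℝ (j - i) f x‖ ≤ B * ‖x‖ ^ (M - (j - i)) := by
    have := lp_taylor (f.smooth ⊤) h0 (norm_iteratedFDeriv_le_seminorm ℝ f M) (M - (j - i))
      (by omega) x
    rwa [show M - (M - (j - i)) = j - i by omega] at this
  have h2 := le_seminorm ℝ (k + (M - (j - i))) i X (t • x)
  rw [norm_smul, Real.norm_of_nonneg ht0.le] at h2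
  set S := SchwartzMap.seminorm ℝ (k + (M - (j - i))) i X
  set P := ‖iteratedFDeriv ℝ i X (t • x)‖
  have hP : 0 ≤ P := norm_nonneg _
  have hB : 0 ≤ B := apply_nonneg _ _
  have hS : t ^ (i+1) * (‖x‖ ^ (k + (M - (j - i))) * P) ≤ S := by
    refine le_trans ?_ h2
    rw [mul_pow, ← mul_assoc]
    have h5 := pow_le_pow_right₀ ht (show i + 1 ≤ k + (M - (j - i)) by omega)
    rw [mul_assoc, mul_assoc]
    exact mul_le_mul_of_nonneg_right h5 (by positivity)
  rw [le_div_iff₀ ht0]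
  calc ‖x‖ ^ k * ((j.choose i : ℝ) * (t ^ i * P) * ‖iteratedFDeriv ℝ (j - i) f x‖) * t
      ≤ ‖x‖ ^ k * ((j.choose i : ℝ) * (t ^ i * P) * (B * ‖x‖ ^ (M - (j - i)))) * t := by gcongr
    _ = (j.choose i : ℝ) * (t ^ (i+1) * (‖x‖ ^ (k + (M - (j - i))) * P)) * B := by ring
    _ ≤ _ := by gcongr

/-- high frequency decay -/
lemma lp_high (X : 𝓢(E, ℝ)) (hX : ∃ ε > (0:ℝ), ∀ x, ‖x‖ ≤ 1 + ε → X x = 1)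
    (f : 𝓢(E, ℂ)) (k j : ℕ) :
    ∃ C : ℝ, ∀ t : ℝ, 0 < t → t ≤ 1 →
      SchwartzMap.seminorm ℝ k j (smulLeftCLM ℂ (fun ξ => X (t • ξ)) f - f) ≤ C * t := by
  set a : E → ℝ := fun x => X x - 1 with ha
  have hac : ContDiff ℝ (⊤ : ℕ∞) a := (X.smooth ⊤).sub contDiff_const
  have hbd : ∀ i, ∃ B, 0 ≤ B ∧ ∀ y, ‖iteratedFDeriv ℝ i a y‖ ≤ B * ‖y‖ := by
    intro i
    obtain ⟨ε, hε, h1⟩ := hX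
    refine ⟨SchwartzMap.seminorm ℝ 0 i X + 1, by positivity, fun y => ?_⟩
    by_cases hy : ‖y‖ < 1 + ε
    · have : a =ᶠ[𝓝 y] fun _ => 0 := by
        have : Metric.ball (0:E) (1+ε) ∈ 𝓝 y := Metric.isOpen_ball.mem_nhds (by simpa using hy)
        filter_upwards [this] with z hz
        simp only [ha]
        rw [h1 z (by simpa using le_of_lt (show ‖z‖ < 1 + ε by simpa using hz))]; simp
      rw [(this.iteratedFDeriv ℝ i).eq_of_nhds]
      simp only [iteratedFDeriv_fun_zero, norm_zero, Pi.zero_apply]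
      positivity
    · push Not at hy
      have h3 : ‖iteratedFDeriv ℝ i a y‖ ≤ SchwartzMap.seminorm ℝ 0 i X + 1 := by
        have h4 : iteratedFDeriv ℝ i a y = iteratedFDeriv ℝ i X y - iteratedFDeriv ℝ i (fun _ => (1:ℝ)) y := by
          exact iteratedFDeriv_sub_apply ((X.smooth i).contDiffAt) contDiffAt_const
        rw [h4]
        refine (norm_sub_le _ _).trans (add_le_add (norm_iteratedFDeriv_le_seminorm ℝ X i y) ?_)
        rcases Nat.eq_zero_or_pos i with rfl | hi
        · simp
        · rw [iteratedFDeriv_const_of_ne hi.ne']; simp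
      refine h3.trans (le_mul_of_one_le_right (by positivity) (by linarith))
  choose B hB0 hB using hbd
  refine ⟨∑ i ∈ Finset.range (j + 1), (j.choose i : ℝ) * B i *
    SchwartzMap.seminorm ℝ (k+1) (j - i) f, fun t ht ht1 => ?_⟩
  have hs : 0 ≤ ∑ i ∈ Finset.range (j + 1), (j.choose i : ℝ) * B i *
    SchwartzMap.seminorm ℝ (k+1) (j - i) f := Finset.sum_nonneg fun i _ =>
      mul_nonneg (mul_nonneg (by positivity) (hB0 i)) (apply_nonneg _ _)
  refine SchwartzMap.seminorm_le_bound ℝ k j _ (by positivity) fun x => ?_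
  have e : ⇑(smulLeftCLM ℂ (fun ξ => X (t • ξ)) f - f) = fun y => a (t • y) • f y := by
    ext y
    rw [_root_.sub_apply, smulLeftCLM_apply_apply (lp_tg X t)]
    simp [ha, sub_mul]
  rw [e]
  refine (mul_le_mul_of_nonneg_left (lp_mul_deriv hac f t ht.le j x) (by positivity)).trans ?_
  rw [Finset.mul_sum, Finset.sum_mul]
  refine Finset.sum_le_sum fun i hi => ?_
  have h2 := le_seminorm ℝ (k+1) (j - i) f x
  have h3 := hB i (t • x)
  rw [norm_smul, Real.norm_of_nonneg ht.le] at h3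
  have hti : t ^ i ≤ 1 := pow_le_one₀ ht.le ht1
  have := hB0 i
  calc ‖x‖ ^ k * ((j.choose i : ℝ) * (t ^ i * ‖iteratedFDeriv ℝ i a (t • x)‖) * ‖iteratedFDeriv ℝ (j - i) f x‖)
      ≤ ‖x‖ ^ k * ((j.choose i : ℝ) * (1 * (B i * (t * ‖x‖))) * ‖iteratedFDeriv ℝ (j - i) f x‖) := by gcongr
    _ = (j.choose i : ℝ) * B i * (‖x‖ ^ (k+1) * ‖iteratedFDeriv ℝ (j - i) f x‖) * t := by ring
    _ ≤ _ := by gcongr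

lemma lp_tendsto_high (X : 𝓢(E, ℝ)) (hX : ∃ ε > (0:ℝ), ∀ x, ‖x‖ ≤ 1 + ε → X x = 1)
    (f : 𝓢(E, ℂ)) (v : 𝓢(E, ℂ) →L[ℝ] ℝ) (t : ℕ → ℝ) (ht0 : ∀ n, 0 < t n)
    (ht : Tendsto t atTop (𝓝 0)) :
    Tendsto (fun n => v (smulLeftCLM ℂ (fun ξ => X (t n • ξ)) f)) atTop (𝓝 (v f)) := by
  refine (v.continuous.tendsto f).comp ?_
  rw [(schwartz_withSeminorms ℝ E ℂ).tendsto_nhds]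
  rintro ⟨k, j⟩ ε hε
  obtain ⟨C, hC⟩ := lp_high X hX f k j
  have h1 : Tendsto (fun n => C * t n) atTop (𝓝 (C * 0)) := ht.const_mul C
  rw [mul_zero] at h1
  filter_upwards [h1.eventually_lt_const hε, ht.eventually_lt_const one_pos] with n hn hn1
  exact (hC (t n) (ht0 n) hn1.le).trans_lt hn

lemma lp_tendsto_low (X : 𝓢(E, ℝ)) (v : 𝓢(E, ℂ) →L[ℝ] ℝ) : ∃ M : ℕ, ∀ f : 𝓢(E, ℂ), 
    (∀ i < M, iteratedFDeriv ℝ i f 0 = 0) → ∀ (t : ℕ → ℝ) (_ : Tendsto t atTop atTop),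
    Tendsto (fun n => v (smulLeftCLM ℂ (fun ξ => X (t n • ξ)) f)) atTop (𝓝 0) := by
  obtain ⟨s, C, -, hC⟩ := Seminorm.bound_of_continuous (schwartz_withSeminorms ℝ E ℂ)
    ((normSeminorm ℝ ℝ).comp (v : 𝓢(E, ℂ) →ₗ[ℝ] ℝ)) (continuous_norm.comp v.continuous)
  refine ⟨s.sup Prod.snd + 1, fun f h0 t ht => ?_⟩
  have h1 : ∀ i ∈ s, Tendsto (fun n => schwartzSeminormFamily ℝ E ℂ i (smulLeftCLM ℂ (fun ξ => X (t n • ξ)) f))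
      atTop (𝓝 0) := by
    rintro ⟨k, j⟩ hi
    obtain ⟨C', hC'⟩ := lp_low X f _ k j (Nat.lt_succ_of_le (Finset.le_sup (f := Prod.snd) hi)) h0
    have h2 : Tendsto (fun n => C' / t n) atTop (𝓝 0) := tendsto_const_nhds.div_atTop ht
    refine squeeze_zero' (Eventually.of_forall fun n => apply_nonneg _ _) ?_ h2
    filter_upwards [ht.eventually_ge_atTop 1] with n hn
    exact hC' _ hn
  have h3 : Tendsto (fun n => (C:ℝ) * ∑ i ∈ s, schwartzSeminormFamily ℝ E ℂ i (smulLeftCLM ℂ (fun ξ => X (t n • ξ)) f))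
      atTop (𝓝 0) := by
    have := (tendsto_finsetSum s h1).const_mul (C:ℝ)
    simpa using this
  refine squeeze_zero_norm (fun n => ?_) h3
  refine (hC (smulLeftCLM ℂ (fun ξ => X (t n • ξ)) f)).trans ?_
  simp only [_root_.smul_apply]
  refine mul_le_mul_of_nonneg_left ?_ C.2
  refine Seminorm.finset_sup_apply_le (Finset.sum_nonneg fun i _ => apply_nonneg _ _) fun i hi => ?_
  exact Finset.single_le_sum (f := fun i => schwartzSeminormFamily ℝ E ℂ i _) (fun i _ => apply_nonneg _ _) hi

end LPAnalysis
section LPFourier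

/-- complexification -/
def lpC {d : ℕ} : 𝓢(Euc d, ℝ) →L[ℝ] 𝓢(Euc d, ℂ) := postcompCLM Complex.ofRealCLM

/-- real part after inverse Fourier -/
def lpR {d : ℕ} : 𝓢(Euc d, ℂ) →L[ℝ] 𝓢(Euc d, ℝ) :=
  (postcompCLM Complex.reCLM).comp 
    ((compCLMOfContinuousLinearEquiv ℝ (LinearIsometryEquiv.neg ℝ (E := Euc d))) ∘L
      (fourierTransformCLM ℝ))

lemma lpR_apply {d : ℕ} (f : 𝓢(Euc d, ℂ)) (x : Euc d) : lpR f x = ((𝓕⁻ f) x).re := rfl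

/-- Fourier side -/
def lpF {d : ℕ} : 𝓢(Euc d, ℝ) →L[ℝ] 𝓢(Euc d, ℂ) := (fourierTransformCLM ℝ).comp lpC

lemma lpF_apply {d : ℕ} (φ : 𝓢(Euc d, ℝ)) : lpF φ = 𝓕 (lpC φ) := rfl

lemma lpC_apply {d : ℕ} (φ : 𝓢(Euc d, ℝ)) (x : Euc d) : lpC φ x = (φ x : ℂ) := rfl

lemma lpR_lpF {d : ℕ} (φ : 𝓢(Euc d, ℝ)) : lpR (lpF φ) = φ := by
  ext x
  rw [lpR_apply, lpF_apply, FourierTransform.fourierInv_fourier_eq, lpC_apply, Complex.ofReal_re]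

/-- low-frequency cutoff -/
def lpS {d : ℕ} (X : 𝓢(Euc d, ℝ)) (t : ℝ) : 𝓢(Euc d, ℝ) →L[ℝ] 𝓢(Euc d, ℝ) :=
  lpR.comp ((smulLeftCLM ℂ (fun ξ => X (t • ξ))).comp lpF)

lemma lpS_apply {d : ℕ} (X : 𝓢(Euc d, ℝ)) (t : ℝ) (φ : 𝓢(Euc d, ℝ)) :
    lpS X t φ = lpR (smulLeftCLM ℂ (fun ξ => X (t • ξ)) (lpF φ)) := rfl

lemma lp_fourier_dil {d : ℕ} (f : Euc d → ℂ) (t : ℝ) (ht : 0 < t) (ξ : Euc d) :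
    𝓕 (fun y => ((t ^ d)⁻¹ : ℝ) * f (t⁻¹ • y)) ξ = 𝓕 f (t • ξ) := by
  rw [Real.fourier_eq, Real.fourier_eq]
  have h := Measure.integral_comp_smul (μ := (volume : Measure (Euc d)))
    (fun v => Real.fourierChar (-(inner ℝ v (t • ξ))) • f v) t⁻¹
  have e : ∀ y : Euc d, inner ℝ (t⁻¹ • y) (t • ξ) = inner ℝ y ξ := by
    intro y
    rw [inner_smul_left, inner_smul_right]
    simp [ht.ne']
  simp only [e] at h
  have h2 : ∀ v : Euc d, Real.fourierChar (-(inner ℝ v ξ)) • (((t ^ d)⁻¹ : ℝ) * f (t⁻¹ • v))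
     = ((t ^ d)⁻¹ : ℝ) • (Real.fourierChar (-(inner ℝ v ξ)) • f (t⁻¹ • v)) := by
    intro v
    simp only [Circle.smul_def, smul_eq_mul, Complex.real_smul]
    ring
  simp only [h2]
  rw [integral_smul, h, smul_smul]
  have : ((t ^ d)⁻¹ * |(t⁻¹ ^ Module.finrank ℝ (Euc d))⁻¹|) = 1 := by
    rw [abs_of_nonneg (by positivity)]
    simp [ht.ne']
  rw [this, one_smul]

/-- the dilated kernel -/
def lpK {d : ℕ} (ψ : 𝓢(Euc d, ℝ)) (t : ℝ) : Euc d → ℝ := fun y => (t ^ d)⁻¹ * ψ (t⁻¹ • y)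

lemma lpK_int {d : ℕ} (ψ : 𝓢(Euc d, ℝ)) (t : ℝ) (ht : 0 < t) : Integrable (lpK ψ t) := by
  unfold lpK
  exact (ψ.integrable.comp_smul (inv_ne_zero ht.ne')).const_mul _

lemma lp_conv {d : ℕ} (X ψ : 𝓢(Euc d, ℝ))
    (hψ : ∀ ξ : Euc d, 𝓕 (fun x => (ψ x : ℂ)) ξ = (X ξ : ℂ)) (t : ℝ) (ht : 0 < t)
    (φ : 𝓢(Euc d, ℝ)) (x : Euc d) :
    (𝓕⁻ (smulLeftCLM ℂ (fun ξ => X (t • ξ)) (lpF φ))) x = ((∫ y, lpK ψ t y * φ (x - y) : ℝ) : ℂ) := by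
  rw [fourierInv_coe, Real.fourierInv_eq]
  set g : Euc d → ℂ := fun ξ => Real.fourierChar (inner ℝ ξ x) • lpF φ ξ with hg
  have hFg : ∀ y, 𝓕 g y = (φ (x - y) : ℂ) := by
    intro y
    rw [Real.fourier_eq]
    have : (φ (x - y) : ℂ) = (𝓕⁻ (lpF φ)) (x - y) := by
      rw [lpF_apply, FourierTransform.fourierInv_fourier_eq, lpC_apply]
    rw [this, fourierInv_coe, Real.fourierInv_eq]
    congr 1 with ξ
    rw [hg]
    simp only [smul_smul]
    rw [← AddChar.map_add_eq_mul, inner_sub_right, neg_add_eq_sub]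
  have hk : ∀ ξ, 𝓕 (fun y => (lpK ψ t y : ℂ)) ξ = (X (t • ξ) : ℂ) := by
    intro ξ
    rw [← hψ, ← lp_fourier_dil _ t ht]
    simp [lpK]
  have hgi : Integrable g := by
    have := (Real.fourierIntegral_convergent_iff (f := lpF φ) (μ := volume) (-x)).2 (lpF φ).integrable
    simpa [hg] using this
  have := VectorFourier.integral_fourierIntegral_smul_eq_flip (e := Real.fourierChar)
    (μ := (volume : Measure (Euc d))) (ν := (volume : Measure (Euc d))) (L := innerₗ (Euc d))
    (f := fun y => (lpK ψ t y : ℂ)) (g := g) Real.continuous_fourierChar (by exact continuous_inner)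
    ((lpK_int ψ t ht).ofReal) hgi
  rw [← integral_complex_ofReal]
  calc _ = ∫ ξ, (𝓕 (fun y => (lpK ψ t y : ℂ)) ξ) • g ξ := by
        congr 1 with ξ
        rw [hk, smulLeftCLM_apply_apply (lp_tg X t), hg]
        simp only [Circle.smul_def, smul_eq_mul, Complex.real_smul]
        ring
    _ = ∫ y, (lpK ψ t y : ℂ) • 𝓕 g y := by
        rw [flip_innerₗ] at this
        exact this
    _ = _ := by
        congr 1 with y
        rw [hFg]
        simp

lemma lpS_eq {d : ℕ} (X ψ : 𝓢(Euc d, ℝ))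
    (hψ : ∀ ξ : Euc d, 𝓕 (fun x => (ψ x : ℂ)) ξ = (X ξ : ℂ)) (t : ℝ) (ht : 0 < t)
    (φ : 𝓢(Euc d, ℝ)) (x : Euc d) : lpS X t φ x = ∫ y, lpK ψ t y * φ (x - y) := by
  rw [lpS_apply, lpR_apply, lp_conv X ψ hψ t ht, Complex.ofReal_re]

lemma lpF_lpS {d : ℕ} (X ψ : 𝓢(Euc d, ℝ))
    (hψ : ∀ ξ : Euc d, 𝓕 (fun x => (ψ x : ℂ)) ξ = (X ξ : ℂ)) (t : ℝ) (ht : 0 < t)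
    (φ : 𝓢(Euc d, ℝ)) : lpF (lpS X t φ) = smulLeftCLM ℂ (fun ξ => X (t • ξ)) (lpF φ) := by
  have : lpC (lpS X t φ) = 𝓕⁻ (smulLeftCLM ℂ (fun ξ => X (t • ξ)) (lpF φ)) := by
    ext x
    rw [lpC_apply, lpS_eq X ψ hψ t ht, lp_conv X ψ hψ t ht]
  rw [lpF_apply, this, FourierTransform.fourier_fourierInv_eq]

/-- composition of cutoffs -/
lemma lpS_lpS {d : ℕ} (X ψ : 𝓢(Euc d, ℝ))
    (hψ : ∀ ξ : Euc d, 𝓕 (fun x => (ψ x : ℂ)) ξ = (X ξ : ℂ)) 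
    (h2 : ∀ x : Euc d, 2 ≤ ‖x‖ → X x = 0) (h1 : ∀ x : Euc d, ‖x‖ ≤ 1 → X x = 1)
    (t t' : ℝ) (ht' : 0 < t') (htt : 2 * t' ≤ t)
    (φ : 𝓢(Euc d, ℝ)) : lpS X t (lpS X t' φ) = lpS X t φ := by
  rw [lpS_apply X t (lpS X t' φ), lpF_lpS X ψ hψ t' ht', lpS_apply]
  congr 1
  ext ξ
  rw [smulLeftCLM_apply_apply (lp_tg X t), smulLeftCLM_apply_apply (lp_tg X t'),
    smulLeftCLM_apply_apply (lp_tg X t)]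
  by_cases h : 2 ≤ ‖t • ξ‖
  · rw [h2 _ h]; simp
  · rw [h1 (t' • ξ), one_smul]
    push Not at h
    rw [norm_smul, Real.norm_of_nonneg (by linarith)] at h ⊢
    have : 2 * t' * ‖ξ‖ ≤ t * ‖ξ‖ := by gcongr
    linarith

/-- moments -/
lemma lp_moment_int {d : ℕ} (φ : 𝓢(Euc d, ℝ)) {n : ℕ} (α : Fin n → Fin d) :
    Integrable (fun x : Euc d => (∏ j, x (α j)) * φ x) := by
  refine (φ.integrable_pow_mul volume n).mono' (Continuous.aestronglyMeasurable (by fun_prop)) ?_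
  refine Eventually.of_forall fun x => ?_
  rw [norm_mul, norm_prod]
  gcongr
  refine (Finset.prod_le_prod (fun _ _ => norm_nonneg _)
    (fun j _ => PiLp.norm_apply_le x (α j))).trans ?_
  simp

lemma lp_moment {d : ℕ} (φ : 𝓢(Euc d, ℝ)) (n : ℕ)
    (h : ∀ α : Fin n → Fin d, ∫ x : Euc d, (∏ j, x (α j)) * φ x = 0) :
    iteratedFDeriv ℝ n (lpF φ) 0 = 0 := by
  have hint : ∀ (k : ℕ), (k : ℕ∞) ≤ (⊤:ℕ∞) → Integrable (fun v : Euc d ↦ ‖v‖ ^ k * ‖lpC φ v‖) :=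
    fun k _ => (lpC φ).integrable_pow_mul volume k
  have h1 : iteratedFDeriv ℝ n (lpF φ) = _ := Real.iteratedFDeriv_fourier (f := lpC φ) (N := ⊤)
    hint (lpC φ).continuous.aestronglyMeasurable (n := n) (by exact_mod_cast le_top)
  have hi : Integrable (fun v : Euc d => VectorFourier.fourierPowSMulRight (innerSL ℝ) (lpC φ) v n) :=
    VectorFourier.integrable_fourierPowSMulRight _ (hint n le_top) (lpC φ).continuous.aestronglyMeasurable
  rw [h1, Real.fourier_eq]
  simp only [inner_zero_right, neg_zero, AddChar.map_zero_eq_one, one_smul]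
  apply ContinuousMultilinearMap.toMultilinearMap_injective
  refine Module.Basis.ext_multilinear (fun _ => (EuclideanSpace.basisFun (Fin d) ℝ).toBasis) fun α => ?_
  simp only [ContinuousMultilinearMap.coe_coe]
  rw [ContinuousMultilinearMap.integral_apply hi]
  simp only [VectorFourier.fourierPowSMulRight_apply]
  have : ∀ v : Euc d, (-(2 * (π:ℂ) * Complex.I)) ^ n • (∏ i, (innerSL ℝ) v ((EuclideanSpace.basisFun (Fin d) ℝ).toBasis (α i))) • lpC φ v
     = (-(2 * (π:ℂ) * Complex.I)) ^ n • (((∏ j, v (α j)) * φ v : ℝ) : ℂ) := by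
    intro v
    congr 1
    simp [lpC_apply]
    left
    refine Finset.prod_congr rfl fun i _ => ?_
    rw [EuclideanSpace.inner_single_right]
    simp
  simp only [this]
  rw [integral_smul, integral_complex_ofReal, h]
  simp

end LPFourier
section LPBounds

lemma lpK_norm {d : ℕ} (ψ : 𝓢(Euc d, ℝ)) (t : ℝ) (ht : 0 < t) (p q : ℝ≥0∞)
    [hpq : p.HolderConjugate q] :
    eLpNorm (lpK ψ t) q volume = ENNReal.ofReal (t ^ (-((d:ℝ) / p.toReal))) * eLpNorm ψ q volume := by
  have h1 : lpK ψ t = (t ^ d)⁻¹ • (ψ ∘ (t⁻¹ • ·)) := rfl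
  have h2 : p⁻¹ + q⁻¹ = 1 := by simpa using ENNReal.HolderTriple.inv_add_inv_eq_inv p q 1
  have hp : p⁻¹ ≠ ∞ := fun h => by simp [h] at h2
  have hq : q⁻¹ ≠ ∞ := fun h => by simp [h] at h2
  have h3 : (p.toReal)⁻¹ + (q.toReal)⁻¹ = 1 := by
    rw [← ENNReal.toReal_inv, ← ENNReal.toReal_inv, ← ENNReal.toReal_add hp hq, h2]; simp
  rw [h1, eLpNorm_const_smul, ← eLpNorm_map_measure ψ.continuous.aestronglyMeasurable
    (by fun_prop), Measure.map_addHaar_smul volume (inv_ne_zero ht.ne'),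
    eLpNorm_smul_measure_of_ne_zero]
  · rw [smul_eq_mul, ← mul_assoc]
    congr 1
    rw [Real.enorm_eq_ofReal (by positivity), ENNReal.ofReal_rpow_of_nonneg (by positivity) (by positivity),
      ← ENNReal.ofReal_mul (by positivity)]
    congr 1
    rw [abs_of_nonneg (by positivity)]
    simp only [finrank_euclideanSpace, Fintype.card_fin, inv_pow, inv_inv, one_div, ENNReal.toReal_inv]
    rw [← Real.rpow_natCast, ← Real.rpow_mul ht.le, ← Real.rpow_neg ht.le, ← Real.rpow_add ht]
    congr 1
    have : (q.toReal)⁻¹ = 1 - (p.toReal)⁻¹ := by linarith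
    rw [this]; ring
  · simp only [ne_eq, ENNReal.ofReal_eq_zero, not_le]
    positivity

lemma lp_young {d : ℕ} (k f g S : Euc d → ℝ) (hk : Continuous k) (hf : Continuous f) (p q : ℝ≥0∞)
    [hpq : p.HolderConjugate q] (hg : AEStronglyMeasurable g volume)
    (hS : ∀ x, S x = ∫ y, k y * f (x - y)) :
    ‖∫ x, g x * S x‖ₑ ≤ eLpNorm k q volume * eLpNorm f 1 volume * eLpNorm g p volume := by
  have hKm : Measurable fun x : Euc d => ‖k x‖ₑ := hk.measurable.enorm
  have hfm : Measurable fun x : Euc d => ‖f x‖ₑ := hf.measurable.enorm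
  have hm : Measurable (Function.uncurry fun (x z : Euc d) => ‖k (x - z)‖ₑ * ‖f z‖ₑ) :=
    (hKm.comp (measurable_fst.sub measurable_snd)).mul (hfm.comp measurable_snd)
  have h1 : ∀ x, ‖S x‖ₑ ≤ ∫⁻ z, ‖k (x - z)‖ₑ * ‖f z‖ₑ := by
    intro x
    rw [hS, ← lintegral_sub_left_eq_self (fun z => ‖k (x - z)‖ₑ * ‖f z‖ₑ) x]
    refine (enorm_integral_le_lintegral_enorm _).trans (le_of_eq ?_)
    simp only [enorm_mul, sub_sub_cancel]
  have h2 : ∀ x, ‖g x * S x‖ₑ ≤ ∫⁻ z, ‖g x‖ₑ * (‖k (x - z)‖ₑ * ‖f z‖ₑ) := by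
    intro x
    have hmx : Measurable fun z => ‖k (x - z)‖ₑ * ‖f z‖ₑ :=
      (hKm.comp (measurable_const.sub measurable_id)).mul hfm
    rw [lintegral_const_mul _ hmx, enorm_mul]
    exact mul_le_mul_right (h1 x) _
  have h3 : ∀ z, ∫⁻ x, ‖g x‖ₑ * (‖k (x - z)‖ₑ * ‖f z‖ₑ) ≤
      ‖f z‖ₑ * (eLpNorm g p volume * eLpNorm k q volume) := by
    intro z
    have e : ∀ x, ‖g x‖ₑ * (‖k (x - z)‖ₑ * ‖f z‖ₑ) = ‖f z‖ₑ * ‖(g • (k ∘ (fun x => x - z))) x‖ₑ := by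
      intro x
      simp only [Pi.smul_apply', Function.comp, smul_eq_mul, enorm_mul]
      ring
    simp only [e]
    rw [lintegral_const_mul' _ _ enorm_ne_top, ← eLpNorm_one_eq_lintegral_enorm]
    have h5 := eLpNorm_smul_le_mul_eLpNorm (p := p) (q := q) (r := 1) (μ := volume)
      (f := k ∘ (fun x => x - z)) (hk.comp (by fun_prop)).aestronglyMeasurable hg
    rw [eLpNorm_comp_measurePreserving hk.aestronglyMeasurable
      (measurePreserving_sub_right volume z)] at h5
    exact mul_le_mul_right h5 _
  have h4 : ∫⁻ x, ∫⁻ z, ‖g x‖ₑ * (‖k (x - z)‖ₑ * ‖f z‖ₑ) = ∫⁻ z, ∫⁻ x, ‖g x‖ₑ * (‖k (x - z)‖ₑ * ‖f z‖ₑ) := by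
    apply lintegral_lintegral_swap
    exact (hg.enorm.comp_fst (ν := volume)).mul hm.aemeasurable
  have h6 : ∫⁻ z, ‖f z‖ₑ * (eLpNorm g p volume * eLpNorm k q volume) =
      eLpNorm k q volume * eLpNorm f 1 volume * eLpNorm g p volume := by
    rw [lintegral_mul_const _ hfm, ← eLpNorm_one_eq_lintegral_enorm]
    ring
  exact (((enorm_integral_le_lintegral_enorm _).trans (lintegral_mono h2)).trans h4.le).trans
    ((lintegral_mono h3).trans h6.le)

lemma lp_sum (a : ℤ → ℝ≥0∞) (r : ℝ≥0∞) (hr : 1 ≤ r) (δ : ℝ) (hδ : 0 ≤ δ) (hδ1 : δ = 0 → r = 1)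
    (h : (if r = ∞ then ⨆ m : ℤ, a m else ∑' m : ℤ, (a m) ^ r.toReal) < ⊤) :
    ∑' n : ℕ, ENNReal.ofReal ((2:ℝ) ^ (-(n:ℝ) * δ)) * a (-(n:ℤ)) ≠ ⊤ := by
  rcases hδ.eq_or_lt with h0 | h0
  · have hr1 := hδ1 h0.symm
    subst hr1
    rw [if_neg (by simp)] at h
    simp only [ENNReal.toReal_one, ENNReal.rpow_one] at h
    simp only [← h0, mul_zero, Real.rpow_zero, ENNReal.ofReal_one, one_mul]
    refine ((ENNReal.tsum_comp_le_tsum_of_injective (f := fun n : ℕ => -(n:ℤ)) (fun x y => by simp) a).trans_lt h).ne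
  · obtain ⟨A, hA, hb⟩ : ∃ A : ℝ≥0∞, A ≠ ⊤ ∧ ∀ m, a m ≤ A := by
      split_ifs at h with hi
      · exact ⟨_, h.ne, fun m => le_iSup a m⟩
      · have hr0 : 0 < r.toReal := ENNReal.toReal_pos (by positivity) hi
        refine ⟨(∑' m : ℤ, (a m) ^ r.toReal) ^ (r.toReal)⁻¹, ENNReal.rpow_ne_top_of_nonneg (by positivity) h.ne, fun m => ?_⟩
        rw [ENNReal.le_rpow_inv_iff hr0]
        exact ENNReal.le_tsum m
    have h2 : ∑' n : ℕ, ENNReal.ofReal ((2:ℝ) ^ (-(n:ℝ) * δ)) ≠ ⊤ := by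
      have e : ∀ n : ℕ, (2:ℝ) ^ (-(n:ℝ) * δ) = ((2:ℝ) ^ (-δ)) ^ n := by
        intro n
        rw [← Real.rpow_natCast, ← Real.rpow_mul (by norm_num)]
        congr 1; ring
      simp only [e]
      refine Summable.tsum_ofReal_ne_top (summable_geometric_of_lt_one (by positivity) ?_)
      exact Real.rpow_lt_one_of_one_lt_of_neg (by norm_num) (by linarith)
    refine ne_top_of_le_ne_top (ENNReal.mul_ne_top h2 hA) ?_
    rw [← ENNReal.tsum_mul_right]
    exact ENNReal.tsum_le_tsum fun n => by gcongr; exact hb _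

lemma lp_hker {d : ℕ} (ψ : 𝓢(Euc d, ℝ)) (m : ℤ) (y : Euc d) :
    hkerZ (⇑ψ) m y = lpK ψ ((2:ℝ) ^ (-m)) y - lpK ψ ((2:ℝ) ^ (-m + 1)) y := by
  have e1 : ((2:ℝ) ^ (-m))⁻¹ = 2 ^ m := by simp
  have e2 : ((2:ℝ) ^ (-m + 1))⁻¹ = (2:ℝ)⁻¹ * 2 ^ m := by
    rw [zpow_add₀ (by norm_num)]; simp [mul_comm]
  have e3 : (((2:ℝ) ^ (-m)) ^ d)⁻¹ = 2 ^ (m * (d:ℤ)) := by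
    rw [← inv_pow, e1, zpow_mul, zpow_natCast]
  have e4 : (((2:ℝ) ^ (-m + 1)) ^ d)⁻¹ = 2 ^ (m * (d:ℤ)) * ((2:ℝ) ^ d)⁻¹ := by
    rw [← inv_pow, e2, mul_pow, zpow_mul, zpow_natCast, inv_pow, mul_comm]
  simp only [hkerZ, lpker, lpK]
  rw [e1, e2, e3, e4, smul_smul]
  ring

lemma lp_D {d : ℕ} (X ψ : 𝓢(Euc d, ℝ))
    (hψ : ∀ ξ : Euc d, 𝓕 (fun x => (ψ x : ℂ)) ξ = (X ξ : ℂ)) 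
    (D : ℤ → (𝓢(Euc d, ℝ) →L[ℝ] 𝓢(Euc d, ℝ)))
    (hD : ∀ (m : ℤ) (φ : 𝓢(Euc d, ℝ)) (x : Euc d),
      D m φ x = ∫ y, hkerZ (⇑ψ) m y * φ (x - y)) (m : ℤ) (φ : 𝓢(Euc d, ℝ)) :
    D m φ = lpS X ((2:ℝ) ^ (-m)) φ - lpS X ((2:ℝ) ^ (-m + 1)) φ := by
  have hint : ∀ (t : ℝ), 0 < t → ∀ x : Euc d, Integrable fun y => lpK ψ t y * φ (x - y) := by
    intro t ht x
    refine (lpK_int ψ t ht).mul_bdd (c := SchwartzMap.seminorm ℝ 0 0 φ)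
      (Continuous.aestronglyMeasurable (by fun_prop)) ?_
    exact Eventually.of_forall fun y => norm_le_seminorm ℝ φ _
  ext x
  rw [hD, _root_.sub_apply, lpS_eq X ψ hψ _ (by positivity), lpS_eq X ψ hψ _ (by positivity),
    ← integral_sub (hint _ (by positivity) x) (hint _ (by positivity) x)]
  congr 1 with y
  rw [lp_hker]; ring

end LPBounds
section LPMain

lemma lp_limit_poly {d : ℕ} (X : 𝓢(Euc d, ℝ)) (u : TD d)
    (hc : ∀ φ : 𝓢(Euc d, ℝ), ∃ l, Tendsto (fun n : ℕ => u (lpS X ((2:ℝ) ^ n) φ)) atTop (𝓝 l)) :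
    ∃ Q : MvPolynomial (Fin d) ℝ, ∀ φ : 𝓢(Euc d, ℝ),
      Tendsto (fun n : ℕ => u (lpS X ((2:ℝ) ^ n) φ)) atTop
        (𝓝 (∫ x, MvPolynomial.eval (fun i => x i) Q * φ x)) := by
  choose l hl using hc
  let K : 𝓢(Euc d, ℝ) →ₗ[ℝ] ℝ :=
    { toFun := l
      map_add' := fun a b => tendsto_nhds_unique (hl (a + b)) (by
        simpa only [map_add] using (hl a).add (hl b))
      map_smul' := fun c a => tendsto_nhds_unique (hl (c • a)) (by
        simpa only [map_smul, RingHom.id_apply] using (hl a).const_smul c) }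
  obtain ⟨M, hM⟩ := lp_tendsto_low X (u.comp lpR)
  let T : (Σ i : Fin M, (Fin i → Fin d)) → 𝓢(Euc d, ℝ) →ₗ[ℝ] ℝ := fun α =>
    { toFun := fun φ => ∫ x : Euc d, (∏ j, x (α.2 j)) * φ x
      map_add' := fun a b => by
        rw [← integral_add (lp_moment_int a α.2) (lp_moment_int b α.2)]
        congr 1 with x
        rw [_root_.add_apply]; ring
      map_smul' := fun c a => by
        rw [RingHom.id_apply, ← integral_smul]
        congr 1 with x
        rw [_root_.smul_apply]; simp only [smul_eq_mul]; ring }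
  have hK : K ∈ Submodule.span ℝ (Set.range T) := by
    refine mem_span_of_iInf_ker_le_ker fun φ hφ => ?_
    simp only [Submodule.mem_iInf, LinearMap.mem_ker] at hφ ⊢
    have h0 := hM (lpF φ) (fun i hi => lp_moment φ i fun α => hφ ⟨⟨i, hi⟩, α⟩) (fun n => (2:ℝ) ^ n)
      (tendsto_pow_atTop_atTop_of_one_lt (by norm_num))
    exact tendsto_nhds_unique (hl φ) h0
  obtain ⟨c, hcK⟩ := (Submodule.mem_span_range_iff_exists_fun ℝ).1 hK
  refine ⟨∑ α, MvPolynomial.C (c α) * ∏ j, MvPolynomial.X (α.2 j), fun φ => ?_⟩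
  convert hl φ using 2
  change _ = K φ
  rw [← hcK]
  simp only [map_sum, map_mul, MvPolynomial.eval_C, map_prod, MvPolynomial.eval_X, Finset.sum_mul]
  rw [integral_finsetSum _ fun α _ => by
    simpa only [mul_assoc] using (lp_moment_int φ α.2).const_mul (c α)]
  rw [LinearMap.sum_apply]
  refine Finset.sum_congr rfl fun α _ => ?_
  simp only [mul_assoc]
  rw [integral_const_mul]
  rfl

lemma lp_telescope (f : ℤ → ℝ) (N : ℕ) :
    ∑ m ∈ Finset.Icc (-(N:ℤ)) (N:ℤ), (f (-m) - f (-m + 1)) = f (-(N:ℤ)) - f ((N:ℤ) + 1) := by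
  induction N with
  | zero => simp
  | succ N ih =>
    have : Finset.Icc (-((N+1:ℕ):ℤ)) ((N+1:ℕ):ℤ)
        = insert (-((N:ℤ)+1)) (insert ((N:ℤ)+1) (Finset.Icc (-(N:ℤ)) (N:ℤ))) := by
      ext m; simp only [Finset.mem_Icc, Finset.mem_insert]; push_cast; omega
    rw [this, Finset.sum_insert (by simp; omega), Finset.sum_insert (by simp), ih]
    push_cast
    ring_nf

lemma lp_block {d : ℕ} (X ψ : 𝓢(Euc d, ℝ))
    (hψX : ∀ ξ : Euc d, 𝓕 (fun x => (ψ x : ℂ)) ξ = (X ξ : ℂ))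
    (hsupp : ∀ x : Euc d, 2 ≤ ‖x‖ → X x = 0) (hX1 : ∀ x : Euc d, ‖x‖ ≤ 1 → X x = 1)
    (D : ℤ → (𝓢(Euc d, ℝ) →L[ℝ] 𝓢(Euc d, ℝ)))
    (hDm : ∀ (m : ℤ) (φ : 𝓢(Euc d, ℝ)),
      D m φ = lpS X ((2:ℝ) ^ (-m)) φ - lpS X ((2:ℝ) ^ (-m + 1)) φ)
    (s : ℝ) (p q : ℝ≥0∞) [hpq : p.HolderConjugate q]
    (u : TD d) (g : ℤ → Euc d → ℝ)
    (hg : ∀ (m : ℤ) (φ : 𝓢(Euc d, ℝ)), u (D m φ) = ∫ x, g m x * φ x)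
    (hgm : ∀ m : ℤ, AEStronglyMeasurable (g m) volume) (φ : 𝓢(Euc d, ℝ)) (n : ℕ) :
    ‖u (D (-(n:ℤ)) φ)‖ₑ ≤
      (ENNReal.ofReal ((2:ℝ) ^ ((d:ℝ) / p.toReal)) * eLpNorm ψ q volume * eLpNorm φ 1 volume) *
        (ENNReal.ofReal ((2:ℝ) ^ (-(n:ℝ) * ((d:ℝ) / p.toReal - s))) *
          (ENNReal.ofReal ((2:ℝ) ^ (((-(n:ℤ) : ℤ):ℝ) * s)) * eLpNorm (g (-(n:ℤ))) p volume)) := by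
  obtain ⟨t, ht⟩ : ∃ t : ℝ, t = (2:ℝ) ^ ((n:ℤ) - 1) := ⟨_, rfl⟩
  have ht0 : 0 < t := by rw [ht]; positivity
  have hDD : D (-(n:ℤ)) (lpS X t φ) = D (-(n:ℤ)) φ := by
    have e1 : (2:ℝ) ^ (n:ℤ) = 2 * t := by
      rw [ht, zpow_sub₀ (by norm_num)]; simp; ring
    have e2 : (2:ℝ) ^ ((n:ℤ) + 1) = 4 * t := by
      rw [ht, zpow_sub₀ (by norm_num), zpow_add₀ (by norm_num)]; simp; ring
    rw [hDm, hDm, neg_neg, lpS_lpS X ψ hψX hsupp hX1 _ t ht0 (by rw [e1]),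
      lpS_lpS X ψ hψX hsupp hX1 _ t ht0 (by rw [e2]; linarith)]
  have hb := lp_young (lpK ψ t) φ (g (-(n:ℤ))) (lpS X t φ) (by unfold lpK; fun_prop)
    φ.continuous p q (hgm _) (lpS_eq X ψ hψX t ht0 φ)
  rw [← hg, hDD, lpK_norm ψ t ht0 p q] at hb
  refine hb.trans (le_of_eq ?_)
  generalize hκ : (d:ℝ) / p.toReal = κ
  have e3 : ENNReal.ofReal (t ^ (-κ)) = ENNReal.ofReal ((2:ℝ) ^ κ) *
      (ENNReal.ofReal ((2:ℝ) ^ (-(n:ℝ) * (κ - s))) *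
        ENNReal.ofReal ((2:ℝ) ^ (((-(n:ℤ) : ℤ):ℝ) * s))) := by
    rw [← ENNReal.ofReal_mul (by positivity), ← ENNReal.ofReal_mul (by positivity)]
    congr 1
    rw [ht, ← Real.rpow_intCast, ← Real.rpow_mul (by norm_num), ← Real.rpow_add (by norm_num),
      ← Real.rpow_add (by norm_num)]
    congr 1
    push_cast
    ring
  rw [e3]
  ring

lemma lp_conv_low {d : ℕ} (X : 𝓢(Euc d, ℝ))
    (D : ℤ → (𝓢(Euc d, ℝ) →L[ℝ] 𝓢(Euc d, ℝ)))
    (hDm : ∀ (m : ℤ) (φ : 𝓢(Euc d, ℝ)),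
      D m φ = lpS X ((2:ℝ) ^ (-m)) φ - lpS X ((2:ℝ) ^ (-m + 1)) φ)
    (u : TD d) (φ : 𝓢(Euc d, ℝ)) (hs : Summable fun n : ℕ => u (D (-(n:ℤ)) φ)) :
    ∃ l, Tendsto (fun n : ℕ => u (lpS X ((2:ℝ) ^ n) φ)) atTop (𝓝 l) := by
  obtain ⟨f, hf⟩ : ∃ f : ℕ → ℝ, ∀ n, f n = u (lpS X ((2:ℝ) ^ n) φ) := ⟨_, fun _ => rfl⟩
  have e : ∀ i : ℕ, u (D (-(i:ℤ)) φ) = f i - f (i+1) := by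
    intro i
    have h1 : (2:ℝ) ^ ((i:ℤ) + 1) = 2 ^ (i + 1) := by
      rw [← zpow_natCast]; push_cast; rfl
    rw [hDm, map_sub, neg_neg, h1, zpow_natCast, hf, hf]
  simp only [e] at hs
  simp only [← hf]
  refine ⟨_, (hs.hasSum.tendsto_sum_nat.const_sub (f 0)).congr fun n => ?_⟩
  rw [Finset.sum_range_sub']
  ring

lemma lp_high_freq {d : ℕ} (X : 𝓢(Euc d, ℝ))
    (hX1 : ∃ ε > (0:ℝ), ∀ x, ‖x‖ ≤ 1 + ε → X x = 1) (u : TD d) (φ : 𝓢(Euc d, ℝ)) :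
    Tendsto (fun N : ℕ => u (lpS X ((2:ℝ) ^ (-(N:ℤ))) φ)) atTop (𝓝 (u φ)) := by
  have h := lp_tendsto_high X hX1 (lpF φ) (u.comp lpR) (fun N : ℕ => (2:ℝ) ^ (-(N:ℤ)))
    (fun n => by positivity) (by
      simp only [zpow_neg, zpow_natCast, ← inv_pow]
      exact tendsto_pow_atTop_nhds_zero_of_lt_one (by norm_num) (by norm_num))
  rw [ContinuousLinearMap.comp_apply, lpR_lpF] at h
  exact h

end LPMain

/-- under the supercriticality condition `s ≤ d/p` (with `r = 1`
if `s = d/p`), any tempered distribution `u` whose homogeneous dyadic blocks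
`Δ̇_m u` are `L^p` functions with `(2^{ms} ‖Δ̇_m u‖_{L^p})_m ∈ ℓ^r(ℤ)` is recovered by
its homogeneous Littlewood-Paley decomposition up to a polynomial:
`u = Q + Σ_{m ∈ ℤ} Δ̇_m u` with convergence in `S'`.
Here `D m` realizes the block `Δ̇_m` on Schwartz functions (the kernels are even, so
`⟨Δ̇_m u, φ⟩ = ⟨u, Δ̇_m φ⟩ = u (D m φ)`), and `g m` is the function representing
`Δ̇_m u`. -/
theorem homogeneous_LP_decomposition_up_to_polynomial
    (d : ℕ) (hd : 1 ≤ d)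
    (χ : Euc d → ℝ) (hχ : IsCutoff d χ)
    (ψ : 𝓢(Euc d, ℝ))
    (hψ : ∀ ξ : Euc d, 𝓕 (fun x => (ψ x : ℂ)) ξ = (χ ξ : ℂ))
    (D : ℤ → (𝓢(Euc d, ℝ) →L[ℝ] 𝓢(Euc d, ℝ)))
    (hD : ∀ (m : ℤ) (φ : 𝓢(Euc d, ℝ)) (x : Euc d),
      D m φ x = ∫ y, hkerZ (⇑ψ) m y * φ (x - y))
    (s : ℝ) (p r : ℝ≥0∞) (hp : 1 ≤ p) (hr : 1 ≤ r)
    (hsc : s ≤ (d:ℝ) / p.toReal)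
    (hsc1 : s = (d:ℝ) / p.toReal → r = 1)
    (u : TD d)
    (g : ℤ → Euc d → ℝ)
    (hg : ∀ (m : ℤ) (φ : 𝓢(Euc d, ℝ)), u (D m φ) = ∫ x, g m x * φ x)
    (hgm : ∀ m : ℤ, AEStronglyMeasurable (g m) volume)
    (hlr : (if r = ∞
        then ⨆ m : ℤ, ENNReal.ofReal ((2:ℝ) ^ ((m:ℝ) * s)) * eLpNorm (g m) p volume
        else ∑' m : ℤ,
          (ENNReal.ofReal ((2:ℝ) ^ ((m:ℝ) * s)) * eLpNorm (g m) p volume) ^ r.toReal)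
      < ⊤) :
    ∃ Q : MvPolynomial (Fin d) ℝ, ∀ φ : 𝓢(Euc d, ℝ),
      Tendsto (fun N : ℕ => ∑ m ∈ Finset.Icc (-(N:ℤ)) (N:ℤ), u (D m φ))
        atTop (𝓝 (u φ - ∫ x, MvPolynomial.eval (fun i => x i) Q * φ x)) := by
  have hcs : HasCompactSupport χ := by
    refine HasCompactSupport.intro (isCompact_closedBall (0 : Euc d) 2) fun x hx => hχ.supp x ?_
    simp only [Metric.mem_closedBall, dist_zero_right, not_le] at hx
    exact hx.le
  obtain ⟨X, hX⟩ : ∃ X : 𝓢(Euc d, ℝ), ∀ x, X x = χ x :=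
    ⟨hcs.toSchwartzMap hχ.smooth, fun x => rfl⟩
  have hψX : ∀ ξ : Euc d, 𝓕 (fun x => (ψ x : ℂ)) ξ = (X ξ : ℂ) := fun ξ => by rw [hX, hψ]
  have hX1 : ∃ ε > (0:ℝ), ∀ x, ‖x‖ ≤ 1 + ε → X x = 1 := by
    simpa only [hX] using hχ.one_near
  have hX1' : ∀ x : Euc d, ‖x‖ ≤ 1 → X x = 1 := by
    obtain ⟨ε, hε, h⟩ := hX1
    exact fun x hx => h x (by linarith)
  have hsupp : ∀ x : Euc d, 2 ≤ ‖x‖ → X x = 0 := fun x hx => (hX x).trans (hχ.supp x hx)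
  have hDm := lp_D X ψ hψX D hD
  obtain ⟨q, hpq⟩ : ∃ q, p.HolderConjugate q := ⟨_, ENNReal.HolderConjugate.conjExponent hp⟩
  have hsum := lp_sum _ r hr ((d:ℝ) / p.toReal - s) (by linarith)
    (fun h => hsc1 (by linarith)) hlr
  have hconv : ∀ φ : 𝓢(Euc d, ℝ),
      ∃ l, Tendsto (fun n : ℕ => u (lpS X ((2:ℝ) ^ n) φ)) atTop (𝓝 l) := by
    intro φ
    refine lp_conv_low X D hDm u φ (Summable.of_enorm ?_)
    refine ne_top_of_le_ne_top ?_ (ENNReal.tsum_le_tsum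
      (lp_block X ψ hψX hsupp hX1' D hDm s p q u g hg hgm φ))
    rw [ENNReal.tsum_mul_left]
    have h1 : eLpNorm ψ q volume ≠ ⊤ := (ψ.eLpNorm_lt_top q volume).ne
    have h2 : eLpNorm φ 1 volume ≠ ⊤ := (φ.eLpNorm_lt_top 1 volume).ne
    exact ENNReal.mul_ne_top (ENNReal.mul_ne_top (ENNReal.mul_ne_top ENNReal.ofReal_ne_top
      h1) h2) hsum
  obtain ⟨Q, hQ⟩ := lp_limit_poly X u hconv
  refine ⟨Q, fun φ => ?_⟩
  have hlow : Tendsto (fun N : ℕ => u (lpS X ((2:ℝ) ^ ((N:ℤ) + 1)) φ)) atTop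
      (𝓝 (∫ x, MvPolynomial.eval (fun i => x i) Q * φ x)) := by
    refine ((hQ φ).comp (tendsto_add_atTop_nat 1)).congr fun n => ?_
    have h1 : (2:ℝ) ^ ((n:ℤ) + 1) = 2 ^ (n + 1) := by
      rw [← zpow_natCast]; push_cast; rfl
    rw [Function.comp_apply, h1]
  refine ((lp_high_freq X hX1 u φ).sub hlow).congr fun N => ?_
  rw [← lp_telescope (fun k => u (lpS X ((2:ℝ) ^ k) φ)) N]
  refine Finset.sum_congr rfl fun m _ => ?_
  rw [hDm, map_sub]

end
end

section
/- Let χ be a low-frequency cut-off as above and let σ : ℝ^d ∖ {0} → ℂ be bounded, homogeneous of degree zero (σ(tξ) = σ(ξ) for all t > 0), continuous away from the origin, and non-constant. Define, for Schwartz f, the tempered distribution T f as the inverse Fourier transform of (1 − χ(ξ)) σ(ξ) f̂(ξ). Then T is not bounded from L^1 to L^1: there is no constant C such that, for every Schwartz function f, the distribution T f is given by an L^1 function with ‖T f‖_{L^1} ≤ C ‖f‖_{L^1}. -/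
open MeasureTheory SchwartzMap Filter Topology Real
open scoped FourierTransform ENNReal

noncomputable section

/-- the high-frequency multiplier `T f = 𝓕⁻¹((1-χ(ξ)) σ(ξ) 𝓕f(ξ))` applied to a
Schwartz function `f`. -/
def hiMult {d : ℕ} (χ : Euc d → ℝ) (σ : Euc d → ℂ) (f : 𝓢(Euc d, ℂ)) :
    Euc d → ℂ :=
  fun x => 𝓕⁻ (fun ξ : Euc d => (1 - (χ ξ : ℂ)) * σ ξ * 𝓕 (⇑f) ξ) x

lemma fourierInv_dilate {d : ℕ} (g : Euc d → ℂ) {R : ℝ} (hR : 0 < R) (x : Euc d) :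
    𝓕⁻ (fun ξ : Euc d => g (R⁻¹ • ξ)) x = (R ^ d) • 𝓕⁻ g (R • x) := by
  rw [Real.fourierInv_eq, Real.fourierInv_eq]
  have h := Measure.integral_comp_inv_smul_of_nonneg (volume : Measure (Euc d))
    (fun v : Euc d => 𝐞 (inner ℝ v (R • x)) • g v) hR.le
  rw [finrank_euclideanSpace, Fintype.card_fin] at h
  rw [← h]
  congr 1
  ext v
  have hi : inner ℝ (R⁻¹ • v) (R • x) = inner ℝ v x := by
    rw [real_inner_smul_left, real_inner_smul_right, inv_mul_cancel_left₀ hR.ne']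
  rw [hi]

lemma integrable_dilate {d : ℕ} {g : Euc d → ℂ} {R : ℝ} (hR : 0 < R) :
    Integrable (fun x : Euc d => (R ^ d) • g (R • x)) ↔ Integrable g := by
  rw [← integrable_comp_smul_iff (volume : Measure (Euc d)) g hR.ne']
  exact integrable_smul_iff (pow_pos hR d).ne' (fun x : Euc d => g (R • x))

lemma eLpNorm_dilate {d : ℕ} {g : Euc d → ℂ} {R : ℝ} (hR : 0 < R) (hg : Integrable g) :
    eLpNorm (fun x : Euc d => (R ^ d) • g (R • x)) 1 volume = eLpNorm g 1 volume := by
  rw [eLpNorm_one_eq_lintegral_enorm, eLpNorm_one_eq_lintegral_enorm,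
    ← ofReal_integral_norm_eq_lintegral_enorm hg,
    ← ofReal_integral_norm_eq_lintegral_enorm ((integrable_dilate hR).2 hg)]
  congr 1
  have hRd := pow_pos hR d
  simp_rw [norm_smul, Real.norm_of_nonneg hRd.le]
  rw [integral_const_mul, Measure.integral_comp_smul_of_nonneg (volume : Measure (Euc d))
    (fun x => ‖g x‖) R (hR := hR.le), finrank_euclideanSpace, Fintype.card_fin, smul_eq_mul,
    mul_inv_cancel_left₀ hRd.ne']

lemma exists_schwartz (d : ℕ) : ∃ ψ : 𝓢(Euc d, ℂ), ψ 0 = 1 := by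
  let b : ContDiffBump (0 : Euc d) := ⟨1, 2, one_pos, one_lt_two⟩
  have h1 : HasCompactSupport (fun x => ((b x : ℝ) : ℂ)) :=
    b.hasCompactSupport.comp_left (g := fun r : ℝ => (r : ℂ)) (by simp)
  have h2 : ContDiff ℝ (⊤ : ℕ∞) (fun x => ((b x : ℝ) : ℂ)) :=
    Complex.ofRealCLM.contDiff.comp b.contDiff
  refine ⟨h1.toSchwartzMap h2, ?_⟩
  show ((b 0 : ℝ) : ℂ) = 1
  rw [b.one_of_mem_closedBall (by simp [b])]
  simp

/-- if `σ` is bounded, homogeneous of degree zero, continuous away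
from the origin and non-constant, then `(Id - χ(D)) σ(D)` is not bounded from `L^1`
to `L^1`. -/
theorem hi_multiplier_not_L1_bounded
    (d : ℕ) (hd : 1 ≤ d)
    (χ : Euc d → ℝ) (hχ : IsCutoff d χ)
    (σ : Euc d → ℂ)
    (hσbdd : ∃ M : ℝ, ∀ ξ, ‖σ ξ‖ ≤ M)
    (hσhom : ∀ (t : ℝ), 0 < t → ∀ ξ : Euc d, σ (t • ξ) = σ ξ)
    (hσcont : ContinuousOn σ {(0 : Euc d)}ᶜ)
    (hσnc : ∃ ξ η : Euc d, ξ ≠ 0 ∧ η ≠ 0 ∧ σ ξ ≠ σ η) :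
    ¬ ∃ C : ℝ, ∀ f : 𝓢(Euc d, ℂ),
        Integrable (hiMult χ σ f) volume ∧
        eLpNorm (hiMult χ σ f) 1 volume
          ≤ ENNReal.ofReal C * eLpNorm (⇑f) 1 volume := by
  rintro ⟨C, hC⟩
  obtain ⟨M, hM⟩ := hσbdd
  obtain ⟨ξ₀, η₀, hξ₀, hη₀, hne⟩ := hσnc
  obtain ⟨ψ, hψ⟩ := exists_schwartz d
  have : Nonempty (Fin d) := ⟨⟨0, hd⟩⟩
  have hσm : AEStronglyMeasurable σ volume := by
    have h := hσcont.aestronglyMeasurable (μ := volume) (measurableSet_singleton (0 : Euc d)).compl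
    rwa [restrict_compl_singleton] at h
  have hχ01 : ∀ x, ‖(1 - (χ x : ℂ))‖ ≤ 1 := by
    intro x
    obtain ⟨ε, hε, h1⟩ := hχ.one_near
    have hle : χ x ≤ 1 := by
      rw [← h1 0 (by simp; positivity)]
      exact hχ.radial_mono 0 x (by simp)
    have hge : 0 ≤ χ x := by
      obtain ⟨y, hy⟩ := exists_norm_eq (Euc d) (c := max 2 ‖x‖) (by positivity)
      rw [← hχ.supp y (by rw [hy]; exact le_max_left _ _)]
      exact hχ.radial_mono x y (by rw [hy]; exact le_max_right _ _)
    rw [← Complex.ofReal_one, ← Complex.ofReal_sub, Complex.norm_real, Real.norm_eq_abs, abs_le]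
    constructor <;> linarith
  -- the dilated multipliers
  let R : ℕ → ℝ := fun n => (n : ℝ) + 1
  have hR : ∀ n, 0 < R n := fun n => by positivity
  let G : ℕ → Euc d → ℂ := fun n ξ => (1 - (χ (R n • ξ) : ℂ)) * σ ξ * ψ ξ
  have hχc : Continuous χ := hχ.smooth.continuous
  have hGm : ∀ n, AEStronglyMeasurable (G n) volume := by
    intro n
    refine AEStronglyMeasurable.mul (AEStronglyMeasurable.mul ?_ hσm)
      ψ.continuous.aestronglyMeasurable
    exact Continuous.aestronglyMeasurable (by fun_prop)
  have hM0 : 0 ≤ M := (norm_nonneg _).trans (hM 0)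
  have hGb : ∀ n ξ, ‖G n ξ‖ ≤ M * ‖ψ ξ‖ := by
    intro n ξ
    simp only [G, norm_mul]
    gcongr
    calc _ ≤ 1 * M := mul_le_mul (hχ01 _) (hM _) (norm_nonneg _) zero_le_one
      _ = M := one_mul M
  have hdom : Integrable (fun ξ => M * ‖ψ ξ‖) (volume : Measure (Euc d)) :=
    ψ.integrable.norm.const_mul M
  let g : Euc d → ℂ := fun ξ => σ ξ * ψ ξ
  have hg : Integrable g := by
    refine hdom.mono' (hσm.mul ψ.continuous.aestronglyMeasurable) (ae_of_all _ fun ξ => ?_)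
    simp only [g, norm_mul]
    gcongr
    exact hM ξ
  have hGint : ∀ n, Integrable (G n) := fun n => hdom.mono' (hGm n) (ae_of_all _ (hGb n))
  have hfc : ∀ h : Euc d → ℂ, Integrable h → Continuous (𝓕 h) := fun h hh =>
    VectorFourier.fourierIntegral_continuous Real.continuous_fourierChar
      (L := innerₗ (Euc d)) continuous_inner hh
  -- pointwise convergence
  have hlim : ∀ x, Tendsto (fun n => 𝓕⁻ (G n) x) atTop (𝓝 (𝓕⁻ g x)) := by
    intro x
    simp_rw [Real.fourierInv_eq]
    have hcc : Continuous fun v : Euc d => 𝐞 (inner ℝ v x) :=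
      Real.continuous_fourierChar.comp (by fun_prop)
    refine tendsto_integral_of_dominated_convergence _ (fun n => ?_) hdom
      (fun n => ae_of_all _ fun v => ?_) ?_
    · exact hcc.aestronglyMeasurable.fun_smul (hGm n)
    · rw [Circle.norm_smul]; exact hGb n v
    · have h0 : ∀ᵐ v : Euc d, v ≠ 0 := by
        simp [ae_iff]
      filter_upwards [h0] with v hv
      apply tendsto_const_nhds.congr'
      have hv' : 0 < ‖v‖ := norm_pos_iff.2 hv
      filter_upwards [eventually_ge_atTop ⌈2 / ‖v‖⌉₊] with n hn
      have h2 : 2 / ‖v‖ ≤ n := (Nat.le_ceil _).trans (by exact_mod_cast hn)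
      have h3 : 2 ≤ ‖R n • v‖ := by
        rw [norm_smul, Real.norm_of_nonneg (hR n).le]
        rw [div_le_iff₀ hv'] at h2
        simp only [R]
        nlinarith
      simp [G, g, hχ.supp _ h3]
  -- test functions
  have key : ∀ n, Integrable (𝓕⁻ (G n)) ∧
      eLpNorm (𝓕⁻ (G n)) 1 volume ≤ ENNReal.ofReal C * eLpNorm (𝓕⁻ (⇑ψ)) 1 volume := by
    intro n
    let e : Euc d ≃L[ℝ] Euc d :=
      ContinuousLinearEquiv.smulLeft (Units.mk0 (R n)⁻¹ (inv_ne_zero (hR n).ne'))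
    let p : 𝓢(Euc d, ℂ) := SchwartzMap.compCLMOfContinuousLinearEquiv ℂ e ψ
    have hp : (⇑p) = fun ξ => ψ ((R n)⁻¹ • ξ) := rfl
    let f : 𝓢(Euc d, ℂ) := 𝓕⁻ p
    have hf1 : 𝓕 (⇑f) = ⇑p := by
      rw [← SchwartzMap.fourier_coe, FourierTransform.fourier_fourierInv_eq]
    have hf2 : (⇑f) = fun x => (R n ^ d) • 𝓕⁻ (⇑ψ) (R n • x) := by
      ext x
      rw [SchwartzMap.fourierInv_coe, hp, fourierInv_dilate _ (hR n)]
    have hT : hiMult χ σ f = fun x => (R n ^ d) • 𝓕⁻ (G n) (R n • x) := by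
      ext x
      rw [← fourierInv_dilate _ (hR n)]
      unfold hiMult
      rw [hf1, hp]
      have hfun : (fun ξ : Euc d => (1 - (χ ξ : ℂ)) * σ ξ * ψ ((R n)⁻¹ • ξ)) =
          fun ξ => G n ((R n)⁻¹ • ξ) := by
        funext ξ
        simp only [G]
        rw [smul_inv_smul₀ (hR n).ne', hσhom _ (inv_pos.2 (hR n))]
      rw [← hfun]
    obtain ⟨h1, h2⟩ := hC f
    rw [hT] at h1 h2
    have h1' := (integrable_dilate (hR n)).1 h1
    refine ⟨h1', ?_⟩
    have hψi : Integrable (𝓕⁻ (⇑ψ)) := by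
      rw [← SchwartzMap.fourierInv_coe]; exact (𝓕⁻ ψ : 𝓢(Euc d, ℂ)).integrable
    rwa [hf2, eLpNorm_dilate (hR n) h1', eLpNorm_dilate (hR n) hψi] at h2
  have hψi : Integrable (𝓕⁻ (⇑ψ)) := by
    rw [← SchwartzMap.fourierInv_coe]; exact (𝓕⁻ ψ : 𝓢(Euc d, ℂ)).integrable
  have hKm : AEStronglyMeasurable (𝓕⁻ g) volume :=
    aestronglyMeasurable_of_tendsto_ae atTop (fun n => (key n).1.1) (ae_of_all _ hlim)
  have hK : Integrable (𝓕⁻ g) := by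
    rw [← memLp_one_iff_integrable]
    refine ⟨hKm, ?_⟩
    refine (Lp.eLpNorm_lim_le_liminf_eLpNorm (fun n => (key n).1.1) _
      (ae_of_all _ hlim)).trans_lt ?_
    refine lt_of_le_of_lt (liminf_le_of_le (by isBoundedDefault)
      (a := ENNReal.ofReal C * eLpNorm (𝓕⁻ (⇑ψ)) 1 volume) ?_) ?_
    · intro b hb
      obtain ⟨n, hn⟩ := hb.exists
      exact hn.trans (key n).2
    · exact ENNReal.mul_lt_top ENNReal.ofReal_lt_top (memLp_one_iff_integrable.2 hψi).2
  have hFg : Integrable (𝓕 g) := by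
    have h := hK.comp_neg
    refine h.congr (ae_of_all _ fun x => ?_)
    simp [Real.fourierInv_eq_fourier_neg]
  have hinv : ∀ v : Euc d, v ≠ 0 → 𝓕 (𝓕⁻ g) v = σ v * ψ v := by
    intro v hv
    refine hg.fourier_fourierInv_eq hFg ?_
    exact (hσcont.continuousAt (isOpen_compl_singleton.mem_nhds hv)).mul ψ.continuous.continuousAt
  have hcont := hfc _ hK
  have hray : ∀ v : Euc d, v ≠ 0 → σ v = 𝓕 (𝓕⁻ g) 0 := by
    intro v hv
    have ht : Tendsto (fun t : ℝ => t • v) (𝓝[>] 0) (𝓝 0) := by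
      have : Continuous fun t : ℝ => t • v := by fun_prop
      have := this.tendsto 0
      rw [zero_smul] at this
      exact this.mono_left nhdsWithin_le_nhds
    have h1 := (hcont.tendsto 0).comp ht
    have h2 : Tendsto (fun t : ℝ => σ v * ψ (t • v)) (𝓝[>] 0) (𝓝 (σ v * ψ 0)) :=
      ((ψ.continuous.tendsto 0).comp ht).const_mul _
    rw [hψ, mul_one] at h2
    refine tendsto_nhds_unique h2 (h1.congr' ?_)
    filter_upwards [self_mem_nhdsWithin] with t ht
    have ht' : (0:ℝ) < t := ht
    simp only [Function.comp]
    rw [hinv _ (smul_ne_zero ht'.ne' hv), hσhom t ht']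
  exact hne ((hray _ hξ₀).trans (hray _ hη₀).symm)

end
end

section
/- There exists a function f ∈ L^∞(ℝ^d) such that f − c does not belong to S'_h for any constant c ∈ ℝ; that is, the inclusion (L^∞ ∩ S'_h) ⊕ ℝ·1 ⊊ L^∞ is strict. Consequently, the inclusion S'_h ⊕ ℝ[x] ⊊ S'(ℝ^d) is strict: there exists a tempered distribution which cannot be written as the sum of an element of S'_h and a polynomial. -/
open MeasureTheory SchwartzMap Filter Topology Real
open scoped FourierTransform

noncomputable section

/-- the dilated kernel `ψ_λ(x) = λ^{-d} ψ(x/λ)` -/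
def dil {d : ℕ} (ψ : Euc d → ℝ) (lam : ℝ) : Euc d → ℝ :=
  fun x => (lam ^ d)⁻¹ * ψ (lam⁻¹ • x)

/-- the condition `f ∈ S'_h` for a scalar bounded function -/
def MemShS {d : ℕ} (ψ : Euc d → ℝ) (f : Euc d → ℝ) : Prop :=
  ∀ φ : 𝓢(Euc d, ℝ),
    Tendsto (fun lam : ℝ => ∫ x, cvS (dil ψ lam) f x * φ x) atTop (𝓝 0)

open scoped Convolution in
lemma dil_schwartz {d : ℕ} (ψ : 𝓢(Euc d, ℝ)) (lam : ℝ) (hl : lam ≠ 0) :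
    ∃ g : 𝓢(Euc d, ℝ), ∀ x, g x = dil (⇑ψ) lam x := by
  refine ⟨(lam ^ d)⁻¹ • compCLMOfContinuousLinearEquiv ℝ
    (ContinuousLinearEquiv.smulLeft (Units.mk0 lam⁻¹ (inv_ne_zero hl)) : Euc d ≃L[ℝ] Euc d) ψ, ?_⟩
  intro x
  simp [dil]

lemma integral_mul_dil {d : ℕ} (ψ h : Euc d → ℝ) (lam : ℝ) (hl : 0 < lam) :
    ∫ x, h x * dil ψ lam x = ∫ x, h (lam • x) * ψ x := by
  have := Measure.integral_comp_inv_smul (volume : Measure (Euc d))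
    (fun x => h (lam • x) * ψ x) lam
  simp only [smul_inv_smul₀ hl.ne', finrank_euclideanSpace, Fintype.card_fin,
    abs_of_pos (pow_pos hl d), smul_eq_mul] at this
  have e : ∀ x, h x * dil ψ lam x = (lam ^ d)⁻¹ * (h x * ψ (lam⁻¹ • x)) := by
    intro x; simp only [dil]; ring
  simp_rw [e]
  rw [integral_const_mul, this, inv_mul_cancel_left₀ (pow_pos hl d).ne']

lemma fourier_dil {d : ℕ} (ψ : Euc d → ℝ) (lam : ℝ) (hl : 0 < lam) (ξ : Euc d) :
    𝓕 (fun x => (dil ψ lam x : ℂ)) ξ = 𝓕 (fun x => (ψ x : ℂ)) (lam • ξ) := by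
  rw [Real.fourier_eq, Real.fourier_eq]
  have := Measure.integral_comp_inv_smul (volume : Measure (Euc d))
    (fun v => Real.fourierChar (-inner ℝ v (lam • ξ)) • (ψ v : ℂ)) lam
  simp only [finrank_euclideanSpace, Fintype.card_fin, abs_of_pos (pow_pos hl d)] at this
  have h2 : ∀ v : Euc d, Real.fourierChar (-inner ℝ v ξ) • (dil ψ lam v : ℂ) =
      (lam ^ d)⁻¹ • (Real.fourierChar (-inner ℝ (lam⁻¹ • v) (lam • ξ)) • (ψ (lam⁻¹ • v) : ℂ)) := by
    intro v
    rw [real_inner_smul_left, real_inner_smul_right, inv_mul_cancel_left₀ hl.ne', smul_comm]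
    congr 1
    simp [dil]
  simp_rw [h2]
  rw [integral_smul, this, smul_smul, inv_mul_cancel₀ (pow_pos hl d).ne', one_smul]

lemma conv_dil {d : ℕ} (χ : Euc d → ℝ) (hχ : IsCutoff d χ) (ψ : 𝓢(Euc d, ℝ))
    (hψ : ∀ ξ : Euc d, 𝓕 (fun x => (ψ x : ℂ)) ξ = (χ ξ : ℂ)) (lam : ℝ) (hl : 2 ≤ lam)
    (x : Euc d) : ∫ y, dil (⇑ψ) lam y * ψ (x - y) = dil (⇑ψ) lam x := by
  have hl0 : 0 < lam := by linarith
  obtain ⟨g, hg⟩ := dil_schwartz ψ lam hl0.ne'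
  let G : 𝓢(Euc d, ℂ) := g.postcompCLM Complex.ofRealCLM
  let P : 𝓢(Euc d, ℂ) := ψ.postcompCLM Complex.ofRealCLM
  have hG : (⇑G) = fun x => (dil ψ lam x : ℂ) := by
    ext x; simp [G, postcompCLM_apply, hg]
  have hP : (⇑P) = fun x => (ψ x : ℂ) := by
    ext x; simp [P, postcompCLM_apply]
  have key : SchwartzMap.convolution (ContinuousLinearMap.mul ℂ ℂ) G P = G := by
    have : 𝓕 (SchwartzMap.convolution (ContinuousLinearMap.mul ℂ ℂ) G P) = 𝓕 G := by
      ext ξ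
      rw [SchwartzMap.fourier_convolution, pairing_apply_apply, fourier_coe, fourier_coe, hG, hP,
        fourier_dil _ _ hl0, hψ, hψ]
      obtain ⟨ε, hε, h1⟩ := hχ.one_near
      by_cases h : ‖ξ‖ ≤ 1 + ε
      · simp [h1 ξ h]
      · have : χ (lam • ξ) = 0 := by
          apply hχ.supp
          rw [norm_smul, Real.norm_eq_abs, abs_of_pos hl0]
          nlinarith
        simp [this]
    have h2 := congrArg (fun F : 𝓢(Euc d, ℂ) => (𝓕⁻ F : 𝓢(Euc d, ℂ))) this
    simpa only [FourierTransform.fourierInv_fourier_eq] using h2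
  have h := DFunLike.congr_fun key x
  rw [SchwartzMap.convolution_apply, hG, hP, MeasureTheory.convolution] at h
  simp only [ContinuousLinearMap.mul_apply'] at h
  have h3 : ∫ t, ((dil (⇑ψ) lam t : ℝ) : ℂ) * ((ψ (x - t) : ℝ) : ℂ)
      = ((∫ y, dil (⇑ψ) lam y * ψ (x - y) : ℝ) : ℂ) := by
    rw [← integral_complex_ofReal]; simp
  rw [h3] at h
  exact_mod_cast h

lemma integral_psi {d : ℕ} (χ : Euc d → ℝ) (hχ : IsCutoff d χ) (ψ : 𝓢(Euc d, ℝ))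
    (hψ : ∀ ξ : Euc d, 𝓕 (fun x => (ψ x : ℂ)) ξ = (χ ξ : ℂ)) : ∫ x, ψ x = 1 := by
  have := hψ 0
  obtain ⟨ε, hε, h1⟩ := hχ.one_near
  rw [Real.fourier_eq, h1 0 (by simp; linarith)] at this
  simp only [inner_zero_right, neg_zero, AddChar.map_zero_eq_one, one_smul] at this
  rw [integral_complex_ofReal] at this
  exact_mod_cast this

/-- the slowly oscillating profile -/
def prof (r : ℝ) : ℝ := Real.sin (Real.log (1 + Real.log (1 + r)))

lemma prof_abs (r : ℝ) : |prof r| ≤ 1 := Real.abs_sin_le_one _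

lemma prof_not_tendsto (L : ℝ) : ¬ Tendsto prof atTop (𝓝 L) := by
  intro h
  have ht : Tendsto (fun s : ℝ => Real.exp (Real.exp s - 1) - 1) atTop atTop := by
    apply tendsto_atTop_add_const_right _ (-1 : ℝ)
    exact Real.tendsto_exp_atTop.comp (tendsto_atTop_add_const_right _ (-1 : ℝ) Real.tendsto_exp_atTop)
  have h2 := h.comp ht
  have e : (prof ∘ fun s : ℝ => Real.exp (Real.exp s - 1) - 1) = Real.sin := by
    ext s; simp [prof]
  rw [e] at h2
  have hn : Tendsto (fun n : ℕ => (n : ℝ) * (2 * π)) atTop atTop :=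
    tendsto_natCast_atTop_atTop.atTop_mul_const (by positivity)
  have hn' := tendsto_atTop_add_const_right _ (π / 2) hn
  have a := h2.comp hn
  have b := h2.comp hn'
  have ea : (Real.sin ∘ fun n : ℕ => (n : ℝ) * (2 * π)) = fun _ => 0 := by
    ext n; simpa using Real.sin_add_nat_mul_two_pi 0 n
  have eb : (Real.sin ∘ fun n : ℕ => (n : ℝ) * (2 * π) + π / 2) = fun _ => 1 := by
    ext n; simpa [add_comm] using Real.sin_add_nat_mul_two_pi (π / 2) n
  rw [ea] at a
  rw [eb] at b
  have := tendsto_nhds_unique a tendsto_const_nhds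
  have := tendsto_nhds_unique b tendsto_const_nhds
  linarith

lemma prof_slow (r : ℝ) (hr : 0 < r) :
    Tendsto (fun lam : ℝ => prof (lam * r) - prof lam) atTop (𝓝 0) := by
  have h1 : Tendsto (fun lam : ℝ => (1 + lam * r) / (1 + lam)) atTop (𝓝 r) := by
    have : Tendsto (fun lam : ℝ => r + (1 - r) / (1 + lam)) atTop (𝓝 (r + 0)) :=
      tendsto_const_nhds.add (tendsto_const_nhds.div_atTop
        (tendsto_atTop_add_const_left _ _ tendsto_id))
    rw [add_zero] at this
    refine this.congr' ?_
    filter_upwards [eventually_gt_atTop 0] with l hl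
    field_simp
    ring
  have h2 := h1.log hr.ne'
  have h3 : Tendsto (fun lam : ℝ => 1 + Real.log (1 + lam)) atTop atTop :=
    tendsto_atTop_add_const_left _ _ (Real.tendsto_log_atTop.comp
      (tendsto_atTop_add_const_left _ _ tendsto_id))
  have h4 := (h2.div_atTop h3).const_add 1
  rw [add_zero] at h4
  have h5 := h4.log one_ne_zero
  rw [Real.log_one] at h5
  refine squeeze_zero_norm' ?_ (by simpa using h5.abs)
  filter_upwards [eventually_gt_atTop 0] with l hl
  have p1 : 0 < 1 + l * r := by positivity
  have q1 : 0 < 1 + Real.log (1 + l) := by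
    have := Real.log_pos (show 1 < 1 + l by linarith); linarith
  have q2 : 0 < 1 + Real.log (1 + l * r) := by
    have := Real.log_pos (show 1 < 1 + l * r by nlinarith [mul_pos hl hr]); linarith
  rw [Real.log_div p1.ne' (by positivity)]
  have e : 1 + (Real.log (1 + l * r) - Real.log (1 + l)) / (1 + Real.log (1 + l))
      = (1 + Real.log (1 + l * r)) / (1 + Real.log (1 + l)) := by
    field_simp; ring
  rw [e, Real.log_div q2.ne' q1.ne']
  simp only [prof]
  exact Real.abs_sin_sub_sin_le _ _

lemma prof_meas : Measurable prof := by
  unfold prof; fun_prop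

lemma g_tendsto {d : ℕ} (hd : 1 ≤ d) (ψ : 𝓢(Euc d, ℝ)) (h1 : ∫ x, ψ x = 1) :
    Tendsto (fun lam : ℝ => (∫ x, prof ‖x‖ * dil (⇑ψ) lam x) - prof lam) atTop (𝓝 0) := by
  haveI : Nonempty (Fin d) := ⟨⟨0, hd⟩⟩
  have hi := ψ.integrable (μ := volume)
  have A : Tendsto (fun lam : ℝ => ∫ x, (prof (lam * ‖x‖) - prof lam) * ψ x) atTop
      (𝓝 (∫ x : Euc d, (0 : ℝ))) := by
    apply tendsto_integral_filter_of_dominated_convergence (fun x => 2 * ‖ψ x‖)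
    · filter_upwards with l
      have := prof_meas
      exact (Measurable.aestronglyMeasurable (by fun_prop)).mul hi.aestronglyMeasurable
    · filter_upwards with l
      filter_upwards with x
      rw [norm_mul]
      gcongr
      have a := abs_le.1 (prof_abs (l * ‖x‖))
      have b := abs_le.1 (prof_abs l)
      rw [Real.norm_eq_abs, abs_le]; constructor <;> linarith
    · exact hi.norm.const_mul 2
    · have : ∀ᵐ x : Euc d, x ≠ 0 := by
        simp [ae_iff]
      filter_upwards [this] with x hx
      simpa using (prof_slow ‖x‖ (norm_pos_iff.2 hx)).mul_const (ψ x)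
  rw [integral_zero] at A
  refine A.congr' ?_
  filter_upwards [eventually_gt_atTop 0] with l hl
  rw [integral_mul_dil ψ (fun x => prof ‖x‖) l hl]
  have hm := prof_meas
  have e : ∀ x : Euc d, (prof (l * ‖x‖) - prof l) * ψ x =
      prof ‖l • x‖ * ψ x - prof l * ψ x := by
    intro x; rw [norm_smul, Real.norm_eq_abs, abs_of_pos hl]; ring
  simp_rw [e]
  rw [integral_sub, integral_const_mul, h1, mul_one]
  · exact hi.bdd_mul (c := 1) (Measurable.aestronglyMeasurable (by fun_prop))
      (Eventually.of_forall fun x => prof_abs _)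
  · exact hi.const_mul _

lemma test_eq {d : ℕ} (χ : Euc d → ℝ) (hχ : IsCutoff d χ) (ψ : 𝓢(Euc d, ℝ))
    (hψ : ∀ ξ : Euc d, 𝓕 (fun x => (ψ x : ℂ)) ξ = (χ ξ : ℂ)) (lam : ℝ) (hl : 2 ≤ lam)
    (f : Euc d → ℝ) (hf : Measurable f) (C : ℝ) (hC : ∀ x, |f x| ≤ C) (he : ∀ x, f (-x) = f x) :
    ∫ x, cvS (dil ψ lam) f x * ψ (-x) = ∫ x, f x * dil ψ lam x := by
  have hl0 : 0 < lam := by linarith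
  obtain ⟨g, hg⟩ := dil_schwartz ψ lam hl0.ne'
  have hg' : dil (⇑ψ) lam = g := by ext x; exact (hg x).symm
  have hconv : ∀ x, ∫ y, g y * ψ (x - y) = g x := by
    intro x; rw [← hg']; exact conv_dil χ hχ ψ hψ lam hl x
  rw [hg']
  have e1 : ∀ x, cvS g f x * ψ (-x) = ∫ t, g (x - t) * f t * ψ (-x) := by
    intro x
    rw [cvS, convolution_eq_swap, ← integral_mul_const]
    simp
  simp_rw [e1]
  have hint : Integrable (fun p : Euc d × Euc d => ψ (-p.2) * g (-(p.1 - p.2))) := by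
    have := (ψ.integrable (μ := volume)).comp_neg.convolution_integrand
      (ContinuousLinearMap.mul ℝ ℝ) (g.integrable (μ := volume)).comp_neg
    exact this
  have hint2 : Integrable (fun p : Euc d × Euc d => f p.1 * (ψ (-p.2) * g (-(p.1 - p.2)))) :=
    hint.bdd_mul (c := C) (Measurable.aestronglyMeasurable (by fun_prop))
      (Eventually.of_forall fun p => hC _)
  rw [integral_integral_swap]
  · have e2 : ∀ t, ∫ x, g (x - t) * f t * ψ (-x) = f t * g (-t) := by
      intro t
      rw [← hconv (-t), ← integral_const_mul,
        ← integral_sub_right_eq_self (fun y => f t * (g y * ψ (-t - y))) t]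
      congr 1; ext x
      rw [show -t - (x - t) = -x by abel]; ring
    simp_rw [e2]
    rw [← integral_neg_eq_self]
    simp [he]
  · have := hint2.swap
    refine this.congr (Eventually.of_forall fun p => ?_)
    simp only [Function.comp, Prod.swap, Function.uncurry, neg_sub]
    ring

lemma exists_W {d : ℕ} (f : Euc d → ℝ) (hf : Measurable f) (hC : ∀ x, |f x| ≤ 1) :
    ∃ W : TD d, ∀ φ : 𝓢(Euc d, ℝ), W φ = ∫ x, f x * φ x := by
  have hi : ∀ φ : 𝓢(Euc d, ℝ), Integrable (fun x => f x * φ x) := fun φ =>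
    (φ.integrable (μ := volume)).bdd_mul (c := 1) hf.aestronglyMeasurable
      (Eventually.of_forall hC)
  refine ⟨mkCLMtoNormedSpace (𝕜 := ℝ) (σ := RingHom.id ℝ) (fun φ => ∫ x, f x * φ x) ?_ ?_ ?_, ?_⟩
  · intro φ η
    rw [← integral_add (hi φ) (hi η)]
    simp [mul_add]
  · intro a φ
    simp only [RingHom.id_apply, smul_eq_mul]
    rw [← integral_const_mul]
    congr 1; ext x; simp; ring
  · obtain ⟨k, C, hC0, h⟩ := norm_toLp_le_seminorm (E := Euc d) ℝ ℝ 1 volume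
    refine ⟨_, C, hC0, fun φ => le_trans ?_ (h φ)⟩
    have e : ∫ a, ‖(φ.toLp 1 volume) a‖ = ∫ a, ‖φ a‖ :=
      integral_congr_ae ((coeFn_toLp φ 1 volume).fun_comp norm)
    rw [L1.norm_eq_integral_norm, e]
    refine (norm_integral_le_integral_norm _).trans ?_
    apply integral_mono (hi φ).norm φ.integrable.norm
    intro x
    simp only [norm_mul]
    exact mul_le_of_le_one_left (norm_nonneg _) (hC x)
  · intro φ; rfl

lemma mono_integrable {d : ℕ} (m : Fin d →₀ ℕ) (φ : 𝓢(Euc d, ℝ)) :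
    Integrable (fun x : Euc d => (m.prod fun i k => x i ^ k) * φ x) := by
  refine (φ.integrable_pow_mul volume m.degree).mono ?_ (Eventually.of_forall fun x => ?_)
  · refine Continuous.aestronglyMeasurable ?_
    refine Continuous.mul ?_ φ.continuous
    unfold Finsupp.prod
    fun_prop
  · rw [norm_mul, norm_mul, norm_norm, norm_pow, norm_norm]
    gcongr
    rw [Finsupp.prod, norm_prod, Finsupp.degree_apply, ← Finset.prod_pow_eq_pow_sum]
    refine Finset.prod_le_prod (fun _ _ => norm_nonneg _) fun i _ => ?_
    rw [norm_pow]
    gcongr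
    exact PiLp.norm_apply_le x i

lemma poly_dil {d : ℕ} (ψ : 𝓢(Euc d, ℝ)) (Q : MvPolynomial (Fin d) ℝ) :
    ∃ p : Polynomial ℝ, ∀ lam : ℝ, 0 < lam →
      ∫ x, MvPolynomial.eval (fun i => x i) Q * dil (⇑ψ) lam x = p.eval lam := by
  refine ⟨∑ m ∈ Q.support, Polynomial.C (Q.coeff m * ∫ x : Euc d, (m.prod fun i k => x i ^ k) * ψ x)
    * Polynomial.X ^ m.degree, fun lam hl => ?_⟩
  rw [integral_mul_dil ψ (fun x => MvPolynomial.eval (fun i => x i) Q) lam hl]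
  have e : ∀ x : Euc d, MvPolynomial.eval (fun i => (lam • x) i) Q * ψ x =
      ∑ m ∈ Q.support, (Q.coeff m * lam ^ m.degree) * ((m.prod fun i k => x i ^ k) * ψ x) := by
    intro x
    rw [MvPolynomial.eval_eq, Finset.sum_mul]
    refine Finset.sum_congr rfl fun m _ => ?_
    simp only [PiLp.smul_apply, smul_eq_mul, mul_pow, Finset.prod_mul_distrib, Finsupp.prod,
      Finset.prod_pow_eq_pow_sum, Finsupp.degree_apply]
    ring
  simp_rw [e]
  rw [integral_finsetSum _ fun m _ => (mono_integrable m ψ).const_mul _]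
  simp only [integral_const_mul, Polynomial.eval_finsetSum, Polynomial.eval_mul,
    Polynomial.eval_C, Polynomial.eval_pow, Polynomial.eval_X]
  refine Finset.sum_congr rfl fun m _ => ?_
  ring

/-- there is a bounded function `f` with `f - c ∉ S'_h` for every
constant `c` (so `(L^∞ ∩ S'_h) ⊕ ℝ·1 ⊊ L^∞`); consequently `S'_h ⊕ ℝ[x] ⊊ S'`:
there is a tempered distribution which is not the sum of an element of `S'_h`
(i.e. a distribution `U` with `U(χ(λD)φ) → 0` for every Schwartz `φ`) and a polynomial.
Here `M lam` is the operator `χ(λD)` acting on Schwartz functions. -/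
theorem Sh_plus_polynomials_strict
    (d : ℕ) (hd : 1 ≤ d)
    (χ : Euc d → ℝ) (hχ : IsCutoff d χ)
    (ψ : 𝓢(Euc d, ℝ))
    (hψ : ∀ ξ : Euc d, 𝓕 (fun x => (ψ x : ℂ)) ξ = (χ ξ : ℂ))
    (M : ℝ → (𝓢(Euc d, ℝ) →L[ℝ] 𝓢(Euc d, ℝ)))
    (hM : ∀ (lam : ℝ) (φ : 𝓢(Euc d, ℝ)) (x : Euc d),
      M lam φ x = ∫ y, dil (⇑ψ) lam y * φ (x - y)) :
    (∃ f : Euc d → ℝ, (∃ C : ℝ, ∀ x, |f x| ≤ C) ∧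
      ∀ c : ℝ, ¬ MemShS (⇑ψ) (fun x => f x - c)) ∧
    (∃ W : TD d, ¬ ∃ (U : TD d) (Q : MvPolynomial (Fin d) ℝ),
      (∀ φ : 𝓢(Euc d, ℝ), Tendsto (fun lam : ℝ => U (M lam φ)) atTop (𝓝 0)) ∧
      (∀ φ : 𝓢(Euc d, ℝ),
        W φ = U φ + ∫ x, MvPolynomial.eval (fun i => x i) Q * φ x)) := by
  have h1 := integral_psi χ hχ ψ hψ
  have hg := g_tendsto hd ψ h1
  have hm := prof_meas
  refine ⟨⟨fun x => prof ‖x‖, ⟨1, fun x => prof_abs _⟩, fun c hc => ?_⟩, ?_⟩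
  · let φ : 𝓢(Euc d, ℝ) := compCLMOfContinuousLinearEquiv ℝ (ContinuousLinearEquiv.neg ℝ) ψ
    have hφ : ∀ x, φ x = ψ (-x) := fun x => rfl
    have h := hc φ
    simp_rw [hφ] at h
    have h' : Tendsto (fun lam : ℝ => (∫ x, prof ‖x‖ * dil (⇑ψ) lam x) - c) atTop (𝓝 0) := by
      refine h.congr' ?_
      filter_upwards [eventually_ge_atTop 2] with l hl
      have hl0 : 0 < l := by linarith
      obtain ⟨g, hg⟩ := dil_schwartz ψ l hl0.ne'
      have hg' : dil (⇑ψ) l = g := by ext x; exact (hg x).symm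
      have hgi := g.integrable (μ := volume)
      rw [test_eq χ hχ ψ hψ l hl (fun x => prof ‖x‖ - c) (by fun_prop) (1 + |c|)
        (fun x => (abs_sub _ _).trans (by gcongr; exact prof_abs _)) (by simp)]
      have e3 : ∫ x, dil (⇑ψ) l x = 1 := by
        have := integral_mul_dil ψ (fun _ => 1) l hl0
        simpa [h1] using this
      simp_rw [sub_mul]
      rw [integral_sub, integral_const_mul, e3, mul_one]
      · rw [hg']
        exact hgi.bdd_mul (c := 1) (Measurable.aestronglyMeasurable (by fun_prop))
          (Eventually.of_forall fun x => prof_abs _)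
      · rw [hg']; exact hgi.const_mul c
    apply prof_not_tendsto c
    have := (h'.sub hg).add_const c
    simpa using this
  · obtain ⟨W, hW⟩ := exists_W (d := d) (fun x => prof ‖x‖) (by fun_prop) (fun x => prof_abs _)
    refine ⟨W, ?_⟩
    rintro ⟨U, Q, hU, hWQ⟩
    obtain ⟨p, hp⟩ := poly_dil ψ Q
    have h := hU ψ
    have h' : Tendsto (fun lam : ℝ => (∫ x, prof ‖x‖ * dil (⇑ψ) lam x) - p.eval lam) atTop
        (𝓝 0) := by
      refine h.congr' ?_
      filter_upwards [eventually_ge_atTop 2] with l hl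
      have hMx : ∀ x, M l ψ x = dil (⇑ψ) l x := fun x => by
        rw [hM, conv_dil χ hχ ψ hψ l hl]
      have h3 := hWQ (M l ψ)
      rw [hW] at h3
      simp_rw [hMx] at h3
      rw [h3, hp l (by linarith)]
      ring
    have h4 : Tendsto (fun l => prof l - p.eval l) atTop (𝓝 0) := by
      have := h'.sub hg
      simpa using this
    have hb : p.degree ≤ 0 := by
      rw [← Polynomial.isBoundedUnder_abs_atTop_iff]
      refine ⟨2, ?_⟩
      rw [eventually_map]
      have := (Metric.tendsto_nhds.1 h4) 1 one_pos
      filter_upwards [this] with l hl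
      rw [Real.dist_eq, sub_zero] at hl
      have a := abs_le.1 (prof_abs l)
      have b := abs_lt.1 hl
      rw [abs_le]; constructor <;> linarith
    rw [Polynomial.eq_C_of_degree_le_zero hb] at h4
    apply prof_not_tendsto (p.coeff 0)
    simpa using h4.add_const (p.coeff 0)

end
end

section
/- For m ≥ 0 let C_m = {x ∈ ℝ^d : 2^{m²} ≤ |x| ≤ 2^{(m+1)²}} and set f = Σ_{m ≥ 0} (−1)^m 1_{C_m} ∈ L^∞(ℝ^d). Then both constant functions 1 and −1 are weak-* accumulation points of the family (χ(λD)f)_{λ > 0} in L^∞ = (L^1)* as λ → +∞: for each sign s ∈ {+1, −1} there is a sequence λ_k → +∞ such that ∫ (χ(λ_k D)f) g dx → s ∫ g dx for every g ∈ L^1(ℝ^d). In particular, f − c ∉ S'_h for every constant c ∈ ℝ. -/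
open MeasureTheory SchwartzMap Filter Topology Real
open scoped FourierTransform

noncomputable section

/-- the annulus `C_m = {2^{m²} ≤ |x| ≤ 2^{(m+1)²}}` -/
def ann (d m : ℕ) : Set (Euc d) :=
  {x : Euc d | (2:ℝ) ^ (m ^ 2) ≤ ‖x‖ ∧ ‖x‖ ≤ (2:ℝ) ^ ((m + 1) ^ 2)}

/-- the function `f = Σ_{m ≥ 0} (-1)^m 1_{C_m}` -/
def annF (d : ℕ) : Euc d → ℝ :=
  fun x => ∑' m : ℕ, ((-1:ℝ)) ^ m * Set.indicator (ann d m) (fun _ => (1:ℝ)) x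

lemma annF_support {d : ℕ} (x : Euc d) : ∃ m₀ : ℕ, ∀ m, m ∉ ({m₀, m₀ + 1} : Finset ℕ) →
    ((-1:ℝ)) ^ m * Set.indicator (ann d m) (fun _ => (1:ℝ)) x = 0 := by
  classical
  by_cases h : ∃ m, x ∈ ann d m
  · refine ⟨Nat.find h, fun m hm => ?_⟩
    have h0 := Nat.find_spec h
    have hnot : x ∉ ann d m := by
      intro hx
      have h1 : Nat.find h ≤ m := Nat.find_min' h hx
      have h2 : Nat.find h + 1 < m := by
        simp only [Finset.mem_insert, Finset.mem_singleton, not_or] at hm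
        omega
      have h3 : (2:ℝ) ^ ((Nat.find h + 1) ^ 2) < 2 ^ (m ^ 2) :=
        pow_lt_pow_right₀ (by norm_num) (Nat.pow_lt_pow_left h2 (by norm_num))
      have := h0.2
      have := hx.1
      linarith
    simp [hnot]
  · refine ⟨0, fun m _ => ?_⟩
    have hnot : x ∉ ann d m := fun hx => h ⟨m, hx⟩
    simp [hnot]

lemma annF_bound {d : ℕ} (x : Euc d) : |annF d x| ≤ 2 := by
  obtain ⟨m₀, h⟩ := annF_support x
  have hb : ∀ m, |((-1:ℝ)) ^ m * Set.indicator (ann d m) (fun _ => (1:ℝ)) x| ≤ 1 := by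
    intro m
    rw [abs_mul, abs_pow, abs_neg, abs_one, one_pow, one_mul]
    by_cases hx : x ∈ ann d m <;> simp [hx]
  unfold annF
  rw [tsum_eq_sum h, Finset.sum_pair (by omega)]
  refine (abs_add_le _ _).trans ?_
  linarith [hb m₀, hb (m₀ + 1)]

lemma annF_measurable (d : ℕ) : Measurable (annF d) := by
  have hm : ∀ m, MeasurableSet (ann d m) := by
    intro m
    exact (measurableSet_le measurable_const measurable_norm).inter
      (measurableSet_le measurable_norm measurable_const)
  refine measurable_of_tendsto_metrizable
    (f := fun n x => ∑ m ∈ Finset.range n,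
      ((-1:ℝ)) ^ m * Set.indicator (ann d m) (fun _ => (1:ℝ)) x) ?_ ?_
  · intro n
    exact Finset.measurable_sum _ fun m _ => (measurable_const.indicator (hm m)).const_mul _
  · rw [tendsto_pi_nhds]
    intro x
    obtain ⟨m₀, h⟩ := annF_support x
    exact (summable_of_ne_finset_zero h).hasSum.tendsto_sum_nat

lemma annF_eq {d : ℕ} (x : Euc d) (m : ℕ) (h1 : (2:ℝ) ^ (m ^ 2) < ‖x‖)
    (h2 : ‖x‖ < (2:ℝ) ^ ((m + 1) ^ 2)) : annF d x = (-1) ^ m := by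
  unfold annF
  rw [tsum_eq_single m]
  · have : x ∈ ann d m := ⟨h1.le, h2.le⟩
    simp [this]
  · intro n hn
    have hnot : x ∉ ann d n := by
      intro hx
      rcases lt_or_gt_of_ne hn with h | h
      · have : (2:ℝ) ^ ((n + 1) ^ 2) ≤ 2 ^ (m ^ 2) :=
          pow_le_pow_right₀ (by norm_num) (Nat.pow_le_pow_left h 2)
        linarith [hx.2]
      · have : (2:ℝ) ^ ((m + 1) ^ 2) ≤ 2 ^ (n ^ 2) :=
          pow_le_pow_right₀ (by norm_num) (Nat.pow_le_pow_left h 2)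
        linarith [hx.1]
    simp [hnot]

lemma annF_eventually {d : ℕ} (x u : Euc d) (hu : u ≠ 0) :
    ∀ᶠ m : ℕ in atTop, annF d (x - (2:ℝ) ^ (m ^ 2 + m) • u) = (-1) ^ m := by
  have hu0 : 0 < ‖u‖ := norm_pos_iff.2 hu
  have ht : Tendsto (fun m : ℕ => (2:ℝ) ^ m) atTop atTop :=
    tendsto_pow_atTop_atTop_of_one_lt (by norm_num)
  filter_upwards [ht.eventually_gt_atTop ((1 + ‖x‖) / ‖u‖), ht.eventually_gt_atTop (‖x‖ + ‖u‖)]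
    with m h1 h2
  rw [div_lt_iff₀ hu0] at h1
  have hn : ‖(2:ℝ) ^ (m ^ 2 + m) • u‖ = 2 ^ (m ^ 2) * (2 ^ m * ‖u‖) := by
    rw [norm_smul, norm_pow, pow_add]; norm_num; ring
  have hA : (1:ℝ) ≤ 2 ^ (m ^ 2) := one_le_pow₀ (by norm_num)
  have hB : (1:ℝ) ≤ 2 ^ m := one_le_pow₀ (by norm_num)
  have hC : (2:ℝ) ^ ((m + 1) ^ 2) = 2 ^ (m ^ 2) * (2 ^ m * (2 ^ m * 2)) := by ring
  have hx0 := norm_nonneg x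
  apply annF_eq
  · have h3 := norm_sub_norm_le ((2:ℝ) ^ (m ^ 2 + m) • u) x
    rw [norm_sub_rev, hn] at h3
    have := mul_lt_mul_of_pos_left h1 (by linarith : (0:ℝ) < 2 ^ (m ^ 2))
    nlinarith
  · have h3 := norm_sub_le x ((2:ℝ) ^ (m ^ 2 + m) • u)
    rw [hn] at h3
    rw [hC]
    have h4 : ‖x‖ ≤ 2 ^ (m ^ 2) * (2 ^ m * ‖x‖) := by
      have : 1 * ‖x‖ ≤ (2 ^ (m ^ 2) * 2 ^ m) * ‖x‖ :=
        mul_le_mul_of_nonneg_right (one_le_mul_of_one_le_of_one_le hA hB) hx0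
      linarith
    have h5 : (2:ℝ) ^ (m ^ 2) * (2 ^ m * (‖x‖ + ‖u‖)) < 2 ^ (m ^ 2) * (2 ^ m * (2 ^ m * 2)) := by
      gcongr
      linarith
    linarith

lemma cvS_dil {d : ℕ} (ψ F : Euc d → ℝ) {lam : ℝ} (hl : 0 < lam) (x : Euc d) :
    cvS (dil ψ lam) F x = ∫ u, ψ u * F (x - lam • u) := by
  have h := Measure.integral_comp_smul (volume : Measure (Euc d))
    (fun t => ψ (lam⁻¹ • t) * F (x - t)) lam
  have h2 : ∀ u : Euc d, lam⁻¹ • lam • u = u := fun u => inv_smul_smul₀ hl.ne' u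
  simp only [h2] at h
  rw [h]
  simp only [cvS, MeasureTheory.convolution, dil, ContinuousLinearMap.mul_apply', smul_eq_mul, mul_assoc]
  rw [integral_const_mul]
  congr 1
  rw [abs_of_pos (by positivity)]
  simp

lemma main_tendsto {d : ℕ} (hd : 1 ≤ d) (ψ : 𝓢(Euc d, ℝ)) (hint : ∫ x, ψ x = 1)
    (F : Euc d → ℝ) (hF : Measurable F) (B : ℝ) (hB : ∀ x, |F x| ≤ B) (s : ℝ)
    (lams : ℕ → ℝ) (hl : ∀ k, 0 < lams k)
    (hlim : ∀ x u : Euc d, u ≠ 0 → Tendsto (fun k => F (x - lams k • u)) atTop (𝓝 s))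
    (g : Euc d → ℝ) (hg : Integrable g) :
    Tendsto (fun k : ℕ => ∫ x, cvS (dil (⇑ψ) (lams k)) F x * g x)
      atTop (𝓝 (s * ∫ x, g x)) := by
  have : Nonempty (Fin d) := ⟨⟨0, hd⟩⟩
  have hψi : Integrable (fun x => ψ x) := ψ.integrable
  have hψm : Measurable (fun x => ψ x) := ψ.continuous.measurable
  simp only [fun k => cvS_dil (⇑ψ) F (hl k)] 
  have hpt : ∀ x : Euc d, ∀ k u, ‖ψ u * F (x - lams k • u)‖ ≤ ‖ψ u‖ * B := by
    intro x k u
    rw [norm_mul]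
    exact mul_le_mul_of_nonneg_left (hB _) (norm_nonneg _)
  have hin : ∀ x : Euc d, Tendsto (fun k => ∫ u, ψ u * F (x - lams k • u)) atTop (𝓝 s) := by
    intro x
    have h1 : ∫ u, ψ u * s = s := by rw [integral_mul_const, hint, one_mul]
    rw [← h1]
    refine tendsto_integral_of_dominated_convergence (fun u => ‖ψ u‖ * B) ?_
      (hψi.norm.mul_const B) ?_ ?_
    · intro k
      exact (hψm.mul (hF.comp (by fun_prop))).aestronglyMeasurable
    · exact fun k => Eventually.of_forall (hpt x k)
    · have : ∀ᵐ u : Euc d, u ≠ 0 := by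
        simp [ae_iff, measure_singleton]
      filter_upwards [this] with u hu
      exact (hlim x u hu).const_mul _
  rw [← integral_const_mul]
  refine tendsto_integral_of_dominated_convergence (fun x => (∫ u, ‖ψ u‖ * B) * ‖g x‖) ?_
      (hg.norm.const_mul _) ?_ ?_
  · intro k
    refine AEStronglyMeasurable.mul ?_ hg.aestronglyMeasurable
    have hj : Measurable (fun p : Euc d × Euc d => ψ p.2 * F (p.1 - lams k • p.2)) :=
      (hψm.comp measurable_snd).mul (hF.comp (by fun_prop))
    exact (hj.stronglyMeasurable.integral_prod_right (ν := volume)).aestronglyMeasurable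
  · intro k
    refine Eventually.of_forall fun x => ?_
    rw [norm_mul]
    refine mul_le_mul_of_nonneg_right ?_ (norm_nonneg _)
    exact norm_integral_le_of_norm_le (hψi.norm.mul_const B) (Eventually.of_forall (hpt x k))
  · exact Eventually.of_forall fun x => (hin x).mul_const _

lemma exists_seq (d : ℕ) (s : ℝ) (hs : s = 1 ∨ s = -1) :
    ∃ lams : ℕ → ℝ, Tendsto lams atTop atTop ∧ (∀ k, 0 < lams k) ∧
      ∀ x u : Euc d, u ≠ 0 → Tendsto (fun k => annF d (x - lams k • u)) atTop (𝓝 s) := by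
  obtain ⟨a, ha⟩ : ∃ a : ℕ, (-1:ℝ) ^ a = s := by
    rcases hs with rfl | rfl
    · exact ⟨0, by simp⟩
    · exact ⟨1, by simp⟩
  have hk : Tendsto (fun k : ℕ => 2 * k + a) atTop atTop :=
    tendsto_atTop_mono (fun k => by simp only [id]; omega) tendsto_id
  refine ⟨fun k => (2:ℝ) ^ ((2 * k + a) ^ 2 + (2 * k + a)), ?_, fun k => by positivity, ?_⟩
  · refine (tendsto_pow_atTop_atTop_of_one_lt (by norm_num : (1:ℝ) < 2)).comp ?_
    exact tendsto_atTop_mono (fun k => by simp) hk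
  · intro x u hu
    refine tendsto_const_nhds.congr' ?_
    filter_upwards [hk.eventually (annF_eventually x u hu)] with k h
    rw [h, pow_add, pow_mul, ← ha]
    simp

/-- both `1` and `-1` are weak-* accumulation points of the family
`(χ(λD)f)_{λ>0}` in `L^∞ = (L^1)*` as `λ → +∞`; in particular `f - c ∉ S'_h`
for every constant `c`. -/
theorem annulus_function_two_accumulation_points
    (d : ℕ) (hd : 1 ≤ d)
    (χ : Euc d → ℝ) (hχ : IsCutoff d χ)
    (ψ : 𝓢(Euc d, ℝ))
    (hψ : ∀ ξ : Euc d, 𝓕 (fun x => (ψ x : ℂ)) ξ = (χ ξ : ℂ)) :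
    (∀ s : ℝ, s = 1 ∨ s = -1 →
      ∃ lams : ℕ → ℝ, Tendsto lams atTop atTop ∧
        ∀ g : Euc d → ℝ, Integrable g volume →
          Tendsto (fun k : ℕ => ∫ x, cvS (dil (⇑ψ) (lams k)) (annF d) x * g x)
            atTop (𝓝 (s * ∫ x, g x))) ∧
    (∀ c : ℝ, ¬ MemShS (⇑ψ) (fun x => annF d x - c)) := by
  have hint : ∫ x, ψ x = 1 := by
    have h := hψ 0
    obtain ⟨ε, hε, h1⟩ := hχ.one_near
    rw [h1 0 (by simp; linarith), Real.fourier_eq] at h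
    simp only [inner_zero_right, neg_zero, AddChar.map_zero_eq_one, one_smul] at h
    rw [integral_complex_ofReal] at h
    exact_mod_cast h
  constructor
  · intro s hs
    obtain ⟨lams, h1, h2, h3⟩ := exists_seq d s hs
    exact ⟨lams, h1, fun g hg => main_tendsto hd ψ hint _ (annF_measurable d) 2 annF_bound s
      lams h2 h3 g hg⟩
  · intro c hc
    have key : ∀ s : ℝ, s = 1 ∨ s = -1 → s - c = 0 := by
      intro s hs
      obtain ⟨lams, h1, h2, h3⟩ := exists_seq d s hs
      have h4 := main_tendsto hd ψ hint (fun x => annF d x - c)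
        ((annF_measurable d).sub_const c) (2 + |c|)
        (fun x => (abs_sub _ _).trans (by linarith [annF_bound x])) (s - c)
        lams h2 (fun x u hu => (h3 x u hu).sub_const c) ψ ψ.integrable
      rw [hint, mul_one] at h4
      exact tendsto_nhds_unique h4 ((hc ψ).comp h1)
    have := key 1 (Or.inl rfl)
    have := key (-1) (Or.inr rfl)
    linarith


end
end
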